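/- Let 2 ≤ k ≤ n, let f₁, …, f_{2n−2k} be smooth functions on M functionally independent at every point of an open dense subset of M, and let ω₀ be an almost symplectic structure on M such that f = ⟨df₁∧⋯∧df_{2n−2k}, Λ₀^{n−k}/(n−k)!⟩ is nonvanishing on an open dense subset U of M. Let σ be a 2-form on M with σ(X_{f_i},·) = 0 for all i, with rank 2k at every point of U, and satisfying 2σ∧δ(σ) = δ(σ∧σ); set g = i_{Λ₀}σ. Then, on U, the (2n−2)-form Φ = −(1/f)(σ + (g/(k−1))ω₀)∧(ω₀^{k−2}/(k−2)!)∧df₁∧⋯∧df_{2n−2k} satisfies Ψ^{-1}(Φ) = Λ₀^#(σ); moreover Λ := Λ₀^#(σ) is a Poisson tensor on M of rank at most 2k at every point, each f_i is a Casimir of Λ, and the bracket of Λ satisfies, for all smooth h₁,h₂ and at every point of U, {h₁,h₂}·Ω = −(1/f) dh₁∧dh₂∧(σ + (g/(k−1))ω₀)∧(ω₀^{k−2}/(k−2)!)∧df₁∧⋯∧df_{2n−2k}. -/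

import Mathlib

namespace Damianou

noncomputable section

/-- Points of `ℝ^N`. -/
abbrev Pt (N : ℕ) := Fin N → ℝ

/-- Raw coordinate representation of a differential `p`-form (or, dually, of a
`p`-vector field): to each point we assign the array of its components. -/
abbrev Form (N p : ℕ) := Pt N → (Fin p → Fin N) → ℝ

/-- The component array of an alternating (antisymmetric) tensor. -/
def AltArr {N p : ℕ} (f : (Fin p → Fin N) → ℝ) : Prop :=
  (∀ (I : Fin p → Fin N) (σ : Equiv.Perm (Fin p)),
      f (I ∘ σ) = ((Equiv.Perm.sign σ : ℤ) : ℝ) * f I) ∧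
  ∀ I : Fin p → Fin N, ¬ Function.Injective I → f I = 0

/-- `ω` is a (smooth) differential `p`-form on the set `M`. -/
def IsFormOn {N p : ℕ} (ω : Form N p) (M : Set (Pt N)) : Prop :=
  (∀ x ∈ M, AltArr (ω x)) ∧ ∀ I, ContDiffOn ℝ (⊤ : ℕ∞) (fun x => ω x I) M

/-- The pairing `⟨η, P⟩` of a `p`-form with a `p`-vector field, determined by
`⟨η₁∧⋯∧η_p, X₁∧⋯∧X_p⟩ = det (⟨η_i, X_j⟩)`. -/
def pairF {N p : ℕ} (η P : Form N p) : Pt N → ℝ :=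
  fun x => (p.factorial : ℝ)⁻¹ * ∑ I : Fin p → Fin N, η x I * P x I

/-- Wedge product (determinant convention). -/
def wedgeF {N : ℕ} (p q : ℕ) (ω : Form N p) (η : Form N q) : Form N (p + q) :=
  fun x I => ((p.factorial : ℝ) * (q.factorial : ℝ))⁻¹ *
    ∑ σ : Equiv.Perm (Fin (p + q)), ((Equiv.Perm.sign σ : ℤ) : ℝ) *
      (ω x fun i => I (σ (Fin.castAdd q i))) * (η x fun j => I (σ (Fin.natAdd p j)))

def smulF {N p : ℕ} (c : ℝ) (ω : Form N p) : Form N p := fun x I => c * ω x I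
def fsmulF {N p : ℕ} (c : Pt N → ℝ) (ω : Form N p) : Form N p := fun x I => c x * ω x I
def addF {N p : ℕ} (ω η : Form N p) : Form N p := fun x I => ω x I + η x I
def subF {N p : ℕ} (ω η : Form N p) : Form N p := fun x I => ω x I - η x I

/-- Cast between (propositionally) equal degrees. -/
def castF {N p q : ℕ} (h : p = q) (ω : Form N p) : Form N q :=
  fun x J => ω x fun t => J (Fin.cast h t)

/-- Total cast, defaulting to `0` when the degrees differ. -/
def castT {N p q : ℕ} (ω : Form N p) : Form N q :=
  if h : p = q then castF h ω else fun _ _ => 0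

/-- Partial derivative `∂f/∂x_i`. -/
def pd {N : ℕ} (f : Pt N → ℝ) (i : Fin N) (x : Pt N) : ℝ :=
  fderiv ℝ f x (Pi.single i 1)

/-- The gradient covector of a function. -/
def grad {N : ℕ} (f : Pt N → ℝ) (x : Pt N) : Fin N → ℝ := fun i => pd f i x

/-- The differential of a function, as a `1`-form. -/
def dF {N : ℕ} (f : Pt N → ℝ) : Form N 1 := fun x I => pd f (I 0) x

/-- Exterior derivative. -/
def extd {N p : ℕ} (ω : Form N p) : Form N (p + 1) :=
  fun x I => ∑ i : Fin (p + 1), (-1 : ℝ) ^ (i : ℕ) *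
    fderiv ℝ (fun y => ω y fun j => I (i.succAbove j)) x (Pi.single (I i) 1)

/-- Concatenation of index blocks of lengths `a` and `b - a` into `Fin b`. -/
def catIdx {N a b : ℕ} (u : Fin a → Fin N) (v : Fin (b - a) → Fin N) : Fin b → Fin N :=
  fun t => if h : (t : ℕ) < a then u ⟨t, h⟩
    else v ⟨(t : ℕ) - a, by have := t.isLt; omega⟩

/-- Concatenation of index blocks of lengths `b - c` and `c` into `Fin b`. -/
def catIdx' {N c b : ℕ} (u : Fin (b - c) → Fin N) (v : Fin c → Fin N) : Fin b → Fin N :=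
  fun t => if h : (t : ℕ) < b - c then u ⟨t, h⟩
    else v ⟨(t : ℕ) - (b - c), by have := t.isLt; omega⟩

/-- Interior product `i_P η` of a `q`-form `η` by a `p`-vector field `P`;
it satisfies `⟨i_P η, Q⟩ = (-1)^{p(p-1)/2} ⟨η, P ∧ Q⟩`. -/
def iF {N : ℕ} (p q : ℕ) (P : Form N p) (η : Form N q) : Form N (q - p) :=
  fun x J => (-1 : ℝ) ^ (p * (p - 1) / 2) * (p.factorial : ℝ)⁻¹ *
    ∑ I : Fin p → Fin N, P x I * η x (catIdx I J)

/-- Interior product `j_η P` of an `r`-vector field `P` by a `q`-form `η`;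
it satisfies `⟨ζ, j_η P⟩ = ⟨ζ ∧ η, P⟩`. -/
def jF {N : ℕ} (q r : ℕ) (η : Form N q) (P : Form N r) : Form N (r - q) :=
  fun x B => (q.factorial : ℝ)⁻¹ * ∑ A : Fin q → Fin N, η x A * P x (catIdx' B A)

/-- The extension of `Λ₀^#` to `p`-forms:
`Λ₀^#(ζ)(α₁,…,α_p) = (-1)^p ζ(Λ₀^#(α₁),…,Λ₀^#(α_p))`, in coordinates. -/
def sharpF {N : ℕ} (Λ : Form N 2) (p : ℕ) (ζ : Form N p) : Form N p :=
  fun x J => (-1 : ℝ) ^ p * ∑ I : Fin p → Fin N, ζ x I * ∏ t, Λ x ![I t, J t]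

/-- `Λ^#` applied to a covector: `⟨β, Λ^#(α)⟩ = Λ(α,β)`. -/
def sharpV {N : ℕ} (Λ : Form N 2) (α : Fin N → ℝ) (x : Pt N) : Fin N → ℝ :=
  fun j => ∑ i, Λ x ![i, j] * α i

/-- The hamiltonian vector field `X_f = Λ₀^#(df)`. -/
def hamV {N : ℕ} (Λ : Form N 2) (f : Pt N → ℝ) (x : Pt N) : Fin N → ℝ :=
  sharpV Λ (grad f x) x

/-- Coefficient matrix of a 2-form (or of a bivector field) at a point. -/
def mat2 {N : ℕ} (ω : Form N 2) (x : Pt N) : Matrix (Fin N) (Fin N) ℝ :=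
  Matrix.of fun i j => ω x ![i, j]

/-- The bracket `{g,h} = Λ(dg,dh)` associated with a bivector field. -/
def braF {N : ℕ} (Λ : Form N 2) (g h : Pt N → ℝ) : Pt N → ℝ :=
  fun x => ∑ i, ∑ j, Λ x ![i, j] * pd g i x * pd h j x

/-- The Jacobi identity for the bracket of `Λ`, for all functions smooth on `M`. -/
def JacobiOn {N : ℕ} (Λ : Form N 2) (M : Set (Pt N)) : Prop :=
  ∀ g h k : Pt N → ℝ, ContDiffOn ℝ (⊤ : ℕ∞) g M → ContDiffOn ℝ (⊤ : ℕ∞) h M →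
    ContDiffOn ℝ (⊤ : ℕ∞) k M →
    ∀ x ∈ M, braF Λ g (braF Λ h k) x + braF Λ h (braF Λ k g) x + braF Λ k (braF Λ g h) x = 0

/-- `f` is a Casimir of `Λ` on `M`, i.e. `Λ(df,·) = 0` on `M`. -/
def CasimirOn {N : ℕ} (Λ : Form N 2) (f : Pt N → ℝ) (M : Set (Pt N)) : Prop :=
  ∀ x ∈ M, ∀ b, ∑ a, Λ x ![a, b] * grad f x a = 0

/-- Wedge powers of a `2`-form (or of a bivector field). -/
def wpow {N : ℕ} (ω : Form N 2) : (m : ℕ) → Form N (2 * m)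
  | 0 => fun _ _ => 1
  | m + 1 => wedgeF (2 * m) 2 (wpow ω m) ω

/-- The wedge `α₁ ∧ ⋯ ∧ α_m` of a family of `1`-forms. -/
def wedgeList {N : ℕ} : (m : ℕ) → (Fin m → Form N 1) → Form N m
  | 0, _ => fun _ _ => 1
  | m + 1, α => wedgeF m 1 (wedgeList m fun i => α i.castSucc) (α (Fin.last m))

/-- `ω₀` is an almost symplectic structure on `M` with associated (nondegenerate)
bivector field `Λ₀`:  `Λ₀^#` is the inverse of `X ↦ -ω₀(X,·)`, which in coordinates
reads `(mat2 ω₀ x) * (mat2 Λ₀ x) = -1`. -/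
def AlmostSymp {N : ℕ} (ω₀ Λ₀ : Form N 2) (M : Set (Pt N)) : Prop :=
  IsFormOn ω₀ M ∧ IsFormOn Λ₀ M ∧ ∀ x ∈ M, mat2 ω₀ x * mat2 Λ₀ x = -1

/-- `ωⁿ/n!`; for an almost symplectic `ω₀` on `ℝ^{2n}` this is the volume form `Ω`,
and for `Λ₀` it is the dual `2n`-vector field `Ω̃`. -/
def volF {N : ℕ} (n : ℕ) (ω : Form N 2) : Form N (2 * n) :=
  smulF ((n.factorial : ℝ)⁻¹) (wpow ω n)

/-- The adjoint `*φ = (-1)^{p(p-1)/2} i_{Λ₀^#(φ)} (ω₀ⁿ/n!)` of a `p`-form. -/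
def adjF {n : ℕ} (ω₀ Λ₀ : Form (2 * n) 2) (p : ℕ) (φ : Form (2 * n) p) :
    Form (2 * n) (2 * n - p) :=
  smulF ((-1 : ℝ) ^ (p * (p - 1) / 2)) (iF p (2 * n) (sharpF Λ₀ p φ) (volF n ω₀))

/-- The codifferential `δ = * ∘ d ∘ *`. -/
def codiffF {n : ℕ} (ω₀ Λ₀ : Form (2 * n) 2) (p : ℕ) (φ : Form (2 * n) p) :
    Form (2 * n) (p - 1) :=
  castT (adjF ω₀ Λ₀ (2 * n - p + 1) (extd (adjF ω₀ Λ₀ p φ)))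

/-- The compatibility condition `2 σ ∧ δ(σ) = δ(σ ∧ σ)` on `M`. -/
def DeltaCond {n : ℕ} (ω₀ Λ₀ σ : Form (2 * n) 2) (M : Set (Pt (2 * n))) : Prop :=
  ∀ x ∈ M, ∀ I : Fin 3 → Fin (2 * n),
    smulF 2 (wedgeF 2 1 σ (codiffF ω₀ Λ₀ 2 σ)) x I = codiffF ω₀ Λ₀ 4 (wedgeF 2 2 σ σ) x I

/-!
STATEMENT 5.  Main theorem (direct part), even-dimensional case:  with
`f = ⟨df₁∧⋯∧df_{2(n-k)}, Λ₀^{n-k}/(n-k)!⟩` and `g = i_{Λ₀}σ`, the `(2n-2)`-form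
`Φ = -(1/f)(σ + (g/(k-1))ω₀)∧(ω₀^{k-2}/(k-2)!)∧df₁∧⋯∧df_{2(n-k)}`
satisfies `Ψ⁻¹(Φ) = Λ₀^#(σ)` on `U`; moreover `Λ = Λ₀^#(σ)` is a Poisson
tensor of rank at most `2k`, each `f_i` is a Casimir of `Λ`, and
`{h₁,h₂}·Ω = -(1/f) dh₁∧dh₂∧(σ + (g/(k-1))ω₀)∧(ω₀^{k-2}/(k-2)!)∧df₁∧⋯∧df_{2(n-k)}`
on `U` for all smooth `h₁,h₂`.
-/

/-- `f = ⟨df₁∧⋯∧df_{2(n-k)}, Λ₀^{n-k}/(n-k)!⟩`. -/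
def fEven {n k : ℕ} (Λ₀ : Form (2 * n) 2) (f : Fin (2 * (n - k)) → Pt (2 * n) → ℝ) :
    Pt (2 * n) → ℝ :=
  pairF (wedgeList (2 * (n - k)) fun i => dF (f i))
    (smulF (((n - k).factorial : ℝ)⁻¹) (wpow Λ₀ (n - k)))

/-- `g = i_{Λ₀}σ = -⟨σ,Λ₀⟩`. -/
def gEven {N : ℕ} (Λ₀ σ : Form N 2) : Pt N → ℝ := fun x => -(pairF σ Λ₀ x)

/-- The core `(2n-2)`-form
`(σ + (g/(k-1))ω₀) ∧ (ω₀^{k-2}/(k-2)!) ∧ df₁∧⋯∧df_{2(n-k)}`. -/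
def coreForm {n : ℕ} (k : ℕ) (ω₀ Λ₀ σ : Form (2 * n) 2)
    (f : Fin (2 * (n - k)) → Pt (2 * n) → ℝ) :
    Form (2 * n) (2 + 2 * (k - 2) + 2 * (n - k)) :=
  wedgeF (2 + 2 * (k - 2)) (2 * (n - k))
    (wedgeF 2 (2 * (k - 2))
      (addF σ (fsmulF (fun x => gEven Λ₀ σ x / ((k : ℝ) - 1)) ω₀))
      (smulF (((k - 2).factorial : ℝ)⁻¹) (wpow ω₀ (k - 2))))
    (wedgeList (2 * (n - k)) fun i => dF (f i))

/-- `Φ = -(1/f) (σ + (g/(k-1))ω₀) ∧ (ω₀^{k-2}/(k-2)!) ∧ df₁∧⋯∧df_{2(n-k)}`. -/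
def PhiForm {n : ℕ} (k : ℕ) (ω₀ Λ₀ σ : Form (2 * n) 2)
    (f : Fin (2 * (n - k)) → Pt (2 * n) → ℝ) :
    Form (2 * n) (2 + 2 * (k - 2) + 2 * (n - k)) :=
  fsmulF (fun x => -(fEven Λ₀ f x)⁻¹) (coreForm k ω₀ Λ₀ σ f)

section

open Finset ExteriorAlgebra
open scoped Matrix

/-- The generalized Kronecker symbol `det (δ_{I s, L t})` of two families of indices. -/
def kdet {N : ℕ} {m : Type*} [Fintype m] [DecidableEq m] (I L : m → Fin N) : ℝ :=
  (Matrix.of fun s t => if I s = L t then (1 : ℝ) else 0).det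

lemma kdet_comp_equiv {N : ℕ} {m m' : Type*} [Fintype m] [DecidableEq m] [Fintype m']
    [DecidableEq m'] (e : m' ≃ m) (I L : m → Fin N) : kdet (I ∘ e) (L ∘ e) = kdet I L := by
  unfold kdet
  rw [← Matrix.det_submatrix_equiv_self e]
  rfl

lemma kdet_comp_perm_left {N : ℕ} {m : Type*} [Fintype m] [DecidableEq m]
    (π : Equiv.Perm m) (I L : m → Fin N) :
    kdet (I ∘ π) L = ((Equiv.Perm.sign π : ℤ) : ℝ) * kdet I L := by
  unfold kdet
  rw [← Matrix.det_permute]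
  rfl

lemma kdet_comm {N : ℕ} {m : Type*} [Fintype m] [DecidableEq m] (I L : m → Fin N) :
    kdet I L = kdet L I := by
  unfold kdet
  rw [← Matrix.det_transpose]
  congr 1
  ext s t
  simp [eq_comm]

lemma kdet_eq_zero_of_not_injective {N : ℕ} {m : Type*} [Fintype m] [DecidableEq m]
    {I : m → Fin N} (L : m → Fin N) (hI : ¬ Function.Injective I) : kdet I L = 0 := by
  unfold Function.Injective at hI
  push Not at hI
  obtain ⟨a, b, hab, hne⟩ := hI
  refine Matrix.det_zero_of_row_eq hne ?_
  ext t
  simp [hab]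

lemma kdet_sumElim_const {N : ℕ} {m : Type*} [Fintype m] [DecidableEq m]
    (I L : m → Fin N) (a : Fin N) :
    kdet (Sum.elim I fun _ : Unit => a) (Sum.elim L fun _ => a)
      = (∏ s, if I s = a then (0 : ℝ) else 1) * kdet I L := by
  have h : (Matrix.of fun s t => if (Sum.elim I fun _ : Unit => a) s
        = (Sum.elim L fun _ : Unit => a) t then (1 : ℝ) else 0)
      = Matrix.fromBlocks (Matrix.of fun s t => if I s = L t then (1 : ℝ) else 0)
          (Matrix.of fun s _ => if I s = a then (1 : ℝ) else 0)
          (Matrix.of fun _ t => if a = L t then (1 : ℝ) else 0) 1 := by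
    ext (s | s) (t | t) <;> first | rfl | simp
  rw [kdet, h, Matrix.det_fromBlocks_one₂₂, kdet, ← Matrix.det_mul_column]
  congr 1
  ext s t
  by_cases h1 : I s = a
  · simp [Matrix.mul_apply, h1]
  · simp [Matrix.mul_apply, h1]

lemma sum_kdet_sumElim_const {N : ℕ} {m : Type*} [Fintype m] [DecidableEq m]
    (I L : m → Fin N) :
    ∑ a, kdet (Sum.elim I fun _ : Unit => a) (Sum.elim L fun _ => a)
      = ((N - Fintype.card m : ℕ) : ℝ) * kdet I L := by
  by_cases hI : Function.Injective I
  · simp only [kdet_sumElim_const, ← Finset.sum_mul]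
    congr 1
    have h1 : ∀ a, (∏ s, if I s = a then (0 : ℝ) else 1)
        = if a ∈ (Finset.univ.image I)ᶜ then (1 : ℝ) else 0 := by
      intro a
      by_cases ha : a ∈ Finset.univ.image I
      · have ha' := ha
        simp only [Finset.mem_image, Finset.mem_univ, true_and] at ha'
        obtain ⟨s, hs⟩ := ha'
        rw [Finset.prod_eq_zero (Finset.mem_univ s) (by simp [hs])]
        simp [ha]
      · rw [Finset.prod_eq_one]
        · simp only [Finset.mem_compl, ha, not_false_eq_true, if_true]
        · intro s _
          have : I s ≠ a := fun h => ha (by simp [← h])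
          simp [this]
    rw [Finset.sum_congr rfl fun a _ => h1 a, Finset.sum_ite_mem]
    simp [Finset.card_compl, Finset.card_image_of_injective _ hI]
  · simp [kdet_sumElim_const, kdet_eq_zero_of_not_injective L hI]

lemma sum_kdet_sumElim {N : ℕ} (r : ℕ) : ∀ {m : Type} [Fintype m] [DecidableEq m]
    (I L : m → Fin N), Fintype.card m + r = N →
    ∑ J : Fin r → Fin N, kdet (Sum.elim I J) (Sum.elim L J) = (r.factorial : ℝ) * kdet I L := by
  induction r with
  | zero =>
    intro m _ _ I L _
    simp only [Finset.univ_unique, Finset.sum_singleton, Nat.factorial_zero, Nat.cast_one, one_mul]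
    rw [← kdet_comp_equiv (Equiv.sumEmpty m (Fin 0)).symm]
    rfl
  | succ r ih =>
    intro m _ _ I L h
    rw [← (Fin.consEquiv (fun _ : Fin (r + 1) => Fin N)).sum_comp, Fintype.sum_prod_type]
    have key : ∀ (a : Fin N) (J : Fin r → Fin N),
        kdet (Sum.elim I (Fin.cons a J : Fin (r + 1) → Fin N))
            (Sum.elim L (Fin.cons a J : Fin (r + 1) → Fin N))
          = kdet (Sum.elim (Sum.elim I fun _ : Unit => a) J)
              (Sum.elim (Sum.elim L fun _ : Unit => a) J) := by
      intro a J
      let e : (m ⊕ Unit) ⊕ Fin r ≃ m ⊕ Fin (r + 1) :=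
        { toFun := Sum.elim (Sum.elim Sum.inl fun _ => Sum.inr 0) fun j => Sum.inr j.succ
          invFun := Sum.elim (fun s => Sum.inl (Sum.inl s))
            (Fin.cases (Sum.inl (Sum.inr ())) Sum.inr)
          left_inv := by rintro ((s | s) | j) <;> rfl
          right_inv := by
            rintro (s | j)
            · rfl
            · induction j using Fin.cases <;> rfl }
      rw [← kdet_comp_equiv e]
      congr 1 <;> · ext ((s | s) | j) <;> rfl
    have hcard : Fintype.card (m ⊕ Unit) + r = N := by simp; omega
    simp only [Fin.consEquiv, Equiv.coe_fn_mk, key]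
    rw [Finset.sum_congr rfl fun a _ => ih _ _ hcard, ← Finset.mul_sum, sum_kdet_sumElim_const,
      show N - Fintype.card m = r + 1 by omega, Nat.factorial_succ]
    push_cast
    ring

lemma sum_mul_kdet {N p : ℕ} {Q : (Fin p → Fin N) → ℝ} (hQ : AltArr Q) (L : Fin p → Fin N) :
    ∑ I, Q I * kdet I L = (p.factorial : ℝ) * Q L := by
  have h : ∀ I, Q I * kdet I L
      = ∑ π : Equiv.Perm (Fin p), if I = L ∘ π.symm then Q L else 0 := by
    intro I
    simp only [kdet, Matrix.det_apply', Matrix.of_apply, Finset.mul_sum]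
    refine Finset.sum_congr rfl fun π _ => ?_
    by_cases hI : I = L ∘ π.symm
    · have : ∏ i, (if I (π i) = L i then (1 : ℝ) else 0) = 1 :=
        Finset.prod_eq_one fun i _ => by simp [hI]
      rw [this, if_pos hI, hI, hQ.1 L π.symm, Equiv.Perm.sign_symm]
      rcases Int.units_eq_one_or (Equiv.Perm.sign π) with h | h <;> simp [h]
    · have : ∏ i, (if I (π i) = L i then (1 : ℝ) else 0) = 0 := by
        obtain ⟨j, hj⟩ := Function.ne_iff.1 hI
        refine Finset.prod_eq_zero (Finset.mem_univ (π.symm j)) ?_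
        simpa using hj
      rw [this, if_neg hI]
      simp
  rw [Finset.sum_congr rfl fun I _ => h I, Finset.sum_comm]
  simp [Fintype.card_perm]

lemma AltArr.eq_kdet_mul {N : ℕ} {F : (Fin N → Fin N) → ℝ} (hF : AltArr F) (I : Fin N → Fin N) :
    F I = kdet I id * F id := by
  by_cases hI : Function.Injective I
  · let e := Equiv.ofBijective I (Finite.injective_iff_bijective.1 hI)
    have h1 := hF.1 id e
    have h2 := kdet_comp_perm_left e (id : Fin N → Fin N) id
    have h3 : kdet (id : Fin N → Fin N) id = 1 := by
      unfold kdet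
      convert Matrix.det_one (n := Fin N) (R := ℝ)
      ext s t
      simp [Matrix.one_apply]
    rw [h3, mul_one] at h2
    exact h1.trans (by rw [← h2]; rfl)
  · rw [hF.2 I hI, kdet_eq_zero_of_not_injective _ hI, zero_mul]

lemma kdet_id_mul_kdet_id {N : ℕ} (I L : Fin N → Fin N) :
    kdet I id * kdet L id = kdet I L := by
  rw [kdet_comm L id]
  unfold kdet
  rw [← Matrix.det_mul]
  congr 1
  ext s t
  simp [Matrix.mul_apply]

lemma altArr_of_perm {N p : ℕ} {f : (Fin p → Fin N) → ℝ}
    (h : ∀ (I : Fin p → Fin N) (σ : Equiv.Perm (Fin p)),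
      f (I ∘ σ) = ((Equiv.Perm.sign σ : ℤ) : ℝ) * f I) : AltArr f := by
  refine ⟨h, fun I hI => ?_⟩
  unfold Function.Injective at hI
  push Not at hI
  obtain ⟨a, b, hab, hne⟩ := hI
  have h1 := h I (Equiv.swap a b)
  have h2 : I ∘ Equiv.swap a b = I := by
    ext t
    simp only [Function.comp]
    rcases eq_or_ne t a with rfl | hta
    · simp [hab]
    · rcases eq_or_ne t b with rfl | htb
      · simp [hab]
      · rw [Equiv.swap_apply_of_ne_of_ne hta htb]
  rw [h2, Equiv.Perm.sign_swap hne] at h1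
  push_cast at h1
  linarith

lemma sum_kdet_mul_prod {N : ℕ} (A : Matrix (Fin N) (Fin N) ℝ) (L : Fin N → Fin N) :
    ∑ K : Fin N → Fin N, kdet K id * ∏ t, A (L t) (K t) = A.det * kdet L id := by
  have h1 : kdet L id = (Matrix.of fun s t => if L s = t then (1 : ℝ) else 0).det := rfl
  rw [mul_comm, h1, ← Matrix.det_mul]
  have h2 : ∀ s : Fin N, ((Matrix.of fun s t => if L s = t then (1 : ℝ) else 0) * A) s
      = ∑ j, A (L s) j • (Pi.single j (1 : ℝ) : Fin N → ℝ) := by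
    intro s
    ext t
    simp [Matrix.mul_apply, Finset.sum_apply, Pi.single_apply]
  have h3 : ((Matrix.of fun s t => if L s = t then (1 : ℝ) else 0) * A).det
      = (Matrix.detRowAlternating (R := ℝ) (n := Fin N)).toMultilinearMap
          (fun s => ∑ j, A (L s) j • (Pi.single j (1 : ℝ) : Fin N → ℝ)) := by
    change Matrix.detRowAlternating _ = Matrix.detRowAlternating _
    congr 1
    ext s : 1
    exact h2 s
  rw [h3, MultilinearMap.map_sum]
  refine Finset.sum_congr rfl fun K _ => ?_
  rw [MultilinearMap.map_smul_univ, smul_eq_mul, mul_comm]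
  congr 1
  change _ = Matrix.det _
  unfold kdet
  congr 1
  ext s t
  simp [Pi.single_apply, eq_comm]

/-- Laplace expansion of an `(N+1)`-ary alternating expression in dimension `N`. -/
lemma sum_kdet_succAbove_eq_zero {N : ℕ} (T : Fin (N + 1) → Fin N) (a : Fin N) :
    ∑ t : Fin (N + 1), (-1 : ℝ) ^ (t : ℕ) * (if T t = a then 1 else 0)
      * kdet (fun j => T (t.succAbove j)) id = 0 := by
  have h := Matrix.det_succ_column_zero
    (Matrix.of fun (t : Fin (N + 1)) (j : Fin (N + 1)) =>
      (Fin.cases (if T t = a then (1 : ℝ) else 0) (fun j => if T t = j then 1 else 0) j : ℝ))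
  rw [Matrix.det_zero_of_column_eq (Fin.succ_ne_zero a).symm (by intro t; simp)] at h
  exact h.symm

/-- The exterior algebra of covectors on `ℝ^N`. -/
abbrev EA (N : ℕ) := ExteriorAlgebra ℝ (Fin N → ℝ)

/-- The element of the exterior algebra with a given component array. -/
def toEA {N p : ℕ} (a : (Fin p → Fin N) → ℝ) : EA N :=
  (p.factorial : ℝ)⁻¹ • ∑ I, a I • ιMulti ℝ p fun s => (Pi.single (I s) 1 : Fin N → ℝ)

lemma ιMulti_comp_perm {N p : ℕ} (v : Fin p → Fin N → ℝ) (σ : Equiv.Perm (Fin p)) :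
    ιMulti ℝ p (fun s => v (σ s)) = ((Equiv.Perm.sign σ : ℤ) : ℝ) • ιMulti ℝ p v := by
  have h := (ιMulti ℝ p).map_perm v σ
  change ιMulti ℝ p (v ∘ σ) = _
  rw [h]
  rcases Int.units_eq_one_or (Equiv.Perm.sign σ) with h | h <;> simp [h]

lemma toEA_wedgeF {N p q : ℕ} (ω : Form N p) (η : Form N q) (x : Pt N) :
    toEA (wedgeF p q ω η x) = toEA (ω x) * toEA (η x) := by
  have hσ : ∀ σ : Equiv.Perm (Fin (p + q)),
      ∑ I : Fin (p + q) → Fin N, (((Equiv.Perm.sign σ : ℤ) : ℝ) *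
          (ω x fun i => I (σ (Fin.castAdd q i))) * (η x fun j => I (σ (Fin.natAdd p j)))) •
        ιMulti ℝ (p + q) (fun s => (Pi.single (I s) 1 : Fin N → ℝ))
      = ∑ I : Fin (p + q) → Fin N, ((ω x fun i => I (Fin.castAdd q i)) *
          (η x fun j => I (Fin.natAdd p j))) •
        ιMulti ℝ (p + q) (fun s => (Pi.single (I s) 1 : Fin N → ℝ)) := by
    intro σ
    rw [← (Equiv.arrowCongr σ (Equiv.refl (Fin N))).sum_comp]
    refine Finset.sum_congr rfl fun I _ => ?_
    have h := ιMulti_comp_perm (fun s => (Pi.single (I s) 1 : Fin N → ℝ)) σ.symm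
    simp only [Equiv.arrowCongr_apply, Equiv.coe_refl, Function.comp_def, id,
      Equiv.symm_apply_apply]
    rw [h, smul_smul, Equiv.Perm.sign_symm]
    congr 1
    rcases Int.units_eq_one_or (Equiv.Perm.sign σ) with h | h <;> simp [h]
  have hsum : ∑ I : Fin (p + q) → Fin N, ((ω x fun i => I (Fin.castAdd q i)) *
          (η x fun j => I (Fin.natAdd p j))) •
        ιMulti ℝ (p + q) (fun s => (Pi.single (I s) 1 : Fin N → ℝ))
      = (∑ I, ω x I • ιMulti ℝ p fun s => (Pi.single (I s) 1 : Fin N → ℝ)) *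
        ∑ I, η x I • ιMulti ℝ q fun s => (Pi.single (I s) 1 : Fin N → ℝ) := by
    rw [← (Fin.appendEquiv p q).sum_comp, Fintype.sum_prod_type, Finset.sum_mul_sum]
    refine Finset.sum_congr rfl fun A _ => Finset.sum_congr rfl fun B _ => ?_
    rw [smul_mul_smul_comm, ιMulti_mul_ιMulti]
    simp only [Fin.appendEquiv_apply, Fin.append_left, Fin.append_right]
    congr 2
    ext s : 1
    refine Fin.addCases (fun i => ?_) (fun j => ?_) s <;> simp
  unfold toEA wedgeF
  simp only [Finset.mul_sum, Finset.sum_smul]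
  rw [Finset.sum_comm]
  have h1 : ∀ σ : Equiv.Perm (Fin (p + q)),
      ∑ I : Fin (p + q) → Fin N, (((p.factorial : ℝ) * (q.factorial : ℝ))⁻¹ *
        (((Equiv.Perm.sign σ : ℤ) : ℝ) *
          (ω x fun i => I (σ (Fin.castAdd q i))) * (η x fun j => I (σ (Fin.natAdd p j))))) •
        ιMulti ℝ (p + q) (fun s => (Pi.single (I s) 1 : Fin N → ℝ))
      = ((p.factorial : ℝ) * (q.factorial : ℝ))⁻¹ •
        ((∑ I, ω x I • ιMulti ℝ p fun s => (Pi.single (I s) 1 : Fin N → ℝ)) *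
        ∑ I, η x I • ιMulti ℝ q fun s => (Pi.single (I s) 1 : Fin N → ℝ)) := by
    intro σ
    rw [← hsum, ← hσ σ, Finset.smul_sum]
    simp only [smul_smul]
  rw [Finset.sum_congr rfl fun σ _ => h1 σ, Finset.sum_const, Finset.card_univ,
    Fintype.card_perm, Fintype.card_fin, smul_mul_smul_comm, ← Nat.cast_smul_eq_nsmul ℝ,
    smul_smul, smul_smul]
  congr 1
  have := Nat.factorial_ne_zero (p + q)
  field_simp

lemma toEA_smul {N p : ℕ} (c : ℝ) (a : (Fin p → Fin N) → ℝ) :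
    toEA (fun I => c * a I) = c • toEA a := by
  simp only [toEA, mul_smul, ← Finset.smul_sum]
  rw [smul_comm]

lemma toEA_add {N p : ℕ} (a b : (Fin p → Fin N) → ℝ) :
    toEA (fun I => a I + b I) = toEA a + toEA b := by
  simp only [toEA, add_smul, Finset.sum_add_distrib, smul_add]

lemma toEA_castF {N p q : ℕ} (h : p = q) (ω : Form N p) (x : Pt N) :
    toEA (castF h ω x) = toEA (ω x) := by
  subst h
  rfl

lemma toEA_wpow {N : ℕ} (ω : Form N 2) (m : ℕ) (x : Pt N) :
    toEA (wpow ω m x) = toEA (ω x) ^ m := by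
  induction m with
  | zero => simp [toEA, wpow]
  | succ m ih =>
    rw [pow_succ, ← ih]
    exact toEA_wedgeF (wpow ω m) ω x

lemma toEA_one {N : ℕ} (v : Fin N → ℝ) : toEA (fun I : Fin 1 → Fin N => v (I 0)) = ι ℝ v := by
  unfold toEA
  rw [← (Equiv.funUnique (Fin 1) (Fin N)).symm.sum_comp]
  simp only [Nat.factorial_one, Nat.cast_one, inv_one, one_smul]
  conv_rhs => rw [pi_eq_sum_univ' v, map_sum]
  refine Finset.sum_congr rfl fun i _ => ?_
  rw [ιMulti_apply, map_smul]
  simp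

lemma ιMulti_succ_last {N p : ℕ} (v : Fin (p + 1) → Fin N → ℝ) :
    ιMulti ℝ (p + 1) v = ιMulti ℝ p (fun i => v i.castSucc) * ι ℝ (v (Fin.last p)) := by
  rw [ιMulti_apply, ιMulti_apply, List.ofFn_succ_last, List.prod_append, List.prod_singleton]

lemma toEA_wedgeList {N : ℕ} (m : ℕ) (α : Fin m → Form N 1) (v : Fin m → Fin N → ℝ) (x : Pt N)
    (h : ∀ i I, α i x I = v i (I 0)) : toEA (wedgeList m α x) = ιMulti ℝ m v := by
  induction m with
  | zero => simp [toEA, wedgeList]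
  | succ m ih =>
    rw [ιMulti_succ_last, wedgeList, toEA_wedgeF, ih _ (fun i => v i.castSucc) fun i I => h _ I,
      ← toEA_one]
    congr 2
    ext I
    exact h _ I

lemma toEA_dF {N : ℕ} (f : Pt N → ℝ) (x : Pt N) : toEA (dF f x) = ι ℝ (grad f x) :=
  toEA_one (grad f x)

/-- Contraction of elements of the exterior algebra of covectors by a linear functional. -/
def ctr {N : ℕ} (d : Module.Dual ℝ (Fin N → ℝ)) : Module.End ℝ (EA N) :=
  CliffordAlgebra.contractLeft (Q := (0 : QuadraticForm ℝ (Fin N → ℝ))) d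

lemma ctr_ι_mul {N : ℕ} (d : Module.Dual ℝ (Fin N → ℝ)) (a : Fin N → ℝ) (b : EA N) :
    ctr d (ι ℝ a * b) = d a • b - ι ℝ a * ctr d b :=
  CliffordAlgebra.contractLeft_ι_mul (Q := (0 : QuadraticForm ℝ (Fin N → ℝ))) _ _ _

lemma ctr_one {N : ℕ} (d : Module.Dual ℝ (Fin N → ℝ)) : ctr d (1 : EA N) = 0 :=
  CliffordAlgebra.contractLeft_one (Q := (0 : QuadraticForm ℝ (Fin N → ℝ))) _

lemma ctr_add {N : ℕ} (d d' : Module.Dual ℝ (Fin N → ℝ)) : ctr (d + d') = ctr d + ctr d' :=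
  map_add (CliffordAlgebra.contractLeft (Q := (0 : QuadraticForm ℝ (Fin N → ℝ)))) d d'

lemma ctr_smul {N : ℕ} (c : ℝ) (d : Module.Dual ℝ (Fin N → ℝ)) : ctr (c • d) = c • ctr d :=
  map_smul (CliffordAlgebra.contractLeft (Q := (0 : QuadraticForm ℝ (Fin N → ℝ)))) c d

lemma ctr_ιMulti {N : ℕ} (d : Module.Dual ℝ (Fin N → ℝ)) (p : ℕ) (v : Fin (p + 1) → Fin N → ℝ) :
    ctr d (ιMulti ℝ (p + 1) v)
      = ∑ t : Fin (p + 1), ((-1 : ℝ) ^ (t : ℕ) * d (v t)) •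
          ιMulti ℝ p (fun j => v (t.succAbove j)) := by
  induction p with
  | zero =>
    rw [ιMulti_succ_apply, ctr_ι_mul, ιMulti_zero_apply, ctr_one]
    simp
  | succ p ih =>
    rw [ιMulti_succ_apply, ctr_ι_mul, ih,
      Fin.sum_univ_succ fun t : Fin (p + 1 + 1) => ((-1 : ℝ) ^ (t : ℕ) * d (v t)) •
        ιMulti ℝ (p + 1) (fun j => v (t.succAbove j))]
    simp only [Fin.val_zero, pow_zero, one_mul, Fin.zero_succAbove, sub_eq_add_neg,
      Matrix.vecTail, Function.comp_def]
    congr 1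
    rw [Finset.mul_sum, ← Finset.sum_neg_distrib]
    refine Finset.sum_congr rfl fun t _ => ?_
    rw [mul_smul_comm, ← neg_smul]
    have h : ιMulti ℝ (p + 1) (fun j => v (t.succ.succAbove j))
        = ι ℝ (v 0) * ιMulti ℝ p (fun j => v (t.succAbove j).succ) := by
      rw [ιMulti_succ_apply]
      simp [Matrix.vecTail, Function.comp_def]
    rw [h, Fin.val_succ, pow_succ]
    congr 1
    ring

/-- The functional `v ↦ ∑ u_i v_i` attached to `u`. -/
def dotDual {N : ℕ} : (Fin N → ℝ) →ₗ[ℝ] Module.Dual ℝ (Fin N → ℝ) := dotProductBilin ℝ ℝ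

lemma dotDual_apply {N : ℕ} (u v : Fin N → ℝ) : dotDual u v = u ⬝ᵥ v := rfl

/-- Iterated contraction by polyvectors. -/
def polyCtr {N : ℕ} : EA N →ₐ[ℝ] Module.End ℝ (EA N) :=
  ExteriorAlgebra.lift ℝ ⟨
    { toFun := fun u => ctr (dotDual u)
      map_add' := fun u v => by rw [map_add, ctr_add]
      map_smul' := fun c u => by rw [map_smul, ctr_smul]; rfl },
    fun u => by
      refine LinearMap.ext fun x => ?_
      exact CliffordAlgebra.contractLeft_contractLeft (Q := (0 : QuadraticForm ℝ (Fin N → ℝ))) _ _⟩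

lemma polyCtr_ι {N : ℕ} (u : Fin N → ℝ) : polyCtr (ι ℝ u) = ctr (dotDual u) := by
  unfold polyCtr
  rw [ExteriorAlgebra.lift_ι_apply]
  rfl

/-- The scalar part of an element of the exterior algebra. -/
def scal {N : ℕ} : EA N →ₐ[ℝ] ℝ := algebraMapInv

lemma scal_ι_mul {N : ℕ} (v : Fin N → ℝ) (x : EA N) : scal (ι ℝ v * x) = 0 := by
  rw [map_mul]
  unfold scal
  simp [algebraMapInv]

lemma scal_polyCtr_ιMulti {N : ℕ} (p : ℕ) (u v : Fin p → Fin N → ℝ) :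
    scal (polyCtr (ιMulti ℝ p u) (ιMulti ℝ p v))
      = (-1 : ℝ) ^ (p * (p - 1) / 2) * (Matrix.of fun s t => u s ⬝ᵥ v t).det := by
  induction p with
  | zero => simp
  | succ p ih =>
    rw [ιMulti_succ_last, map_mul, polyCtr_ι, Module.End.mul_apply, ctr_ιMulti, map_sum, map_sum,
      Matrix.det_succ_row _ (Fin.last p), Finset.mul_sum]
    refine Finset.sum_congr rfl fun t _ => ?_
    rw [map_smul, map_smul, ih, dotDual_apply, smul_eq_mul]
    have h : (p + 1) * (p + 1 - 1) / 2 = p * (p - 1) / 2 + p := by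
      have := Nat.triangle_succ p
      rw [this]
    have h2 : ((-1 : ℝ) ^ p) * (-1) ^ p = 1 := by rw [← mul_pow]; simp
    rw [h, pow_add, pow_add, Fin.val_last]
    have h3 : (Matrix.of fun s t => u s ⬝ᵥ v t).submatrix (Fin.last p).succAbove t.succAbove
        = Matrix.of fun (s t' : Fin p) => u s.castSucc ⬝ᵥ v (t.succAbove t') := by
      ext s t'
      simp
    rw [h3, Matrix.of_apply]
    linear_combination (-1 : ℝ) ^ (t : ℕ) * (u (Fin.last p) ⬝ᵥ v t) * (-1) ^ (p * (p - 1) / 2) *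
      (Matrix.of fun (s t' : Fin p) => u s.castSucc ⬝ᵥ v (t.succAbove t')).det * (-h2)

lemma scal_polyCtr_ιMulti_toEA {N p : ℕ} {η : (Fin p → Fin N) → ℝ} (hη : AltArr η)
    (L : Fin p → Fin N) :
    scal (polyCtr (ιMulti ℝ p fun s => (Pi.single (L s) 1 : Fin N → ℝ)) (toEA η))
      = (-1 : ℝ) ^ (p * (p - 1) / 2) * η L := by
  unfold toEA
  simp only [map_smul, map_sum, scal_polyCtr_ιMulti, smul_eq_mul]
  have h : ∀ I : Fin p → Fin N,
      (Matrix.of fun s t => (Pi.single (L s) 1 : Fin N → ℝ) ⬝ᵥ Pi.single (I t) 1).det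
        = kdet I L := by
    intro I
    rw [kdet_comm]
    unfold kdet
    congr 1
    ext s t
    simp [Pi.single_apply, eq_comm]
  simp only [h]
  have h2 := sum_mul_kdet hη L
  have h3 : ∑ I, η I * ((-1 : ℝ) ^ (p * (p - 1) / 2) * kdet I L)
      = (-1 : ℝ) ^ (p * (p - 1) / 2) * ((p.factorial : ℝ) * η L) := by
    rw [← h2, Finset.mul_sum]
    exact Finset.sum_congr rfl fun I _ => by ring
  rw [h3]
  have := Nat.factorial_ne_zero p
  field_simp

lemma toEA_injective {N p : ℕ} {η ζ : (Fin p → Fin N) → ℝ} (hη : AltArr η) (hζ : AltArr ζ)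
    (h : toEA η = toEA ζ) (L : Fin p → Fin N) : η L = ζ L := by
  have h1 := scal_polyCtr_ιMulti_toEA hη L
  rw [h, scal_polyCtr_ιMulti_toEA hζ L] at h1
  exact (mul_left_cancel₀ (pow_ne_zero _ (by norm_num)) h1).symm

lemma scal_polyCtr_toEA_ιMulti {N p : ℕ} {P : (Fin p → Fin N) → ℝ} (hP : AltArr P)
    (J : Fin p → Fin N) :
    scal (polyCtr (toEA P) (ιMulti ℝ p fun s => (Pi.single (J s) 1 : Fin N → ℝ)))
      = (-1 : ℝ) ^ (p * (p - 1) / 2) * P J := by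
  rw [← scal_polyCtr_ιMulti_toEA hP J]
  unfold toEA
  simp only [map_smul, map_sum, LinearMap.smul_apply, LinearMap.sum_apply, smul_eq_mul,
    scal_polyCtr_ιMulti]
  congr 1
  refine Finset.sum_congr rfl fun I _ => ?_
  congr 2
  rw [← Matrix.det_transpose]
  congr 1
  ext s t
  exact dotProduct_comm (Pi.single _ 1 : Fin N → ℝ) _

lemma scal_polyCtr_toEA {N p : ℕ} {P : (Fin p → Fin N) → ℝ} (hP : AltArr P)
    (η : (Fin p → Fin N) → ℝ) :
    scal (polyCtr (toEA P) (toEA η))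
      = (-1 : ℝ) ^ (p * (p - 1) / 2) * ((p.factorial : ℝ)⁻¹ * ∑ I, η I * P I) := by
  have h2 : toEA η = (p.factorial : ℝ)⁻¹ • ∑ I, η I •
      ιMulti ℝ p fun s => (Pi.single (I s) 1 : Fin N → ℝ) := rfl
  rw [h2]
  simp only [map_smul, map_sum, scal_polyCtr_toEA_ιMulti hP, smul_eq_mul]
  rw [Finset.mul_sum, Finset.mul_sum, Finset.mul_sum]
  refine Finset.sum_congr rfl fun I _ => ?_
  ring

lemma altArr_wedgeF {N p q : ℕ} (ω : Form N p) (η : Form N q) (x : Pt N) :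
    AltArr (wedgeF p q ω η x) := by
  refine altArr_of_perm fun I τ => ?_
  unfold wedgeF
  rw [mul_left_comm]
  congr 1
  rw [Finset.mul_sum]
  refine Fintype.sum_equiv (Equiv.mulLeft τ) _ _ fun σ => ?_
  simp only [Equiv.coe_mulLeft, Function.comp_apply, Equiv.Perm.mul_apply, map_mul]
  rcases Int.units_eq_one_or (Equiv.Perm.sign τ) with h | h <;> simp [h]

lemma altArr_wpow {N : ℕ} (ω : Form N 2) (m : ℕ) (x : Pt N) : AltArr (wpow ω m x) := by
  cases m with
  | zero =>
    refine altArr_of_perm fun I σ => ?_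
    have : σ = 1 := Subsingleton.elim (α := Equiv.Perm (Fin 0)) _ _
    subst this
    simp [wpow]
  | succ m => exact altArr_wedgeF (wpow ω m) ω x

lemma AltArr.const_mul {N p : ℕ} {a : (Fin p → Fin N) → ℝ} (h : AltArr a) (c : ℝ) :
    AltArr fun I => c * a I :=
  altArr_of_perm fun I σ => by rw [h.1 I σ]; ring

lemma altArr_volF {N : ℕ} (m : ℕ) (ω : Form N 2) (x : Pt N) : AltArr (volF m ω x) :=
  (altArr_wpow ω m x).const_mul _

lemma altArr_castF {N p q : ℕ} (h : p = q) {ω : Form N p} {x : Pt N} (hω : AltArr (ω x)) :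
    AltArr (castF h ω x) := by
  subst h
  exact hω

/-- The degree-`r` part of the exterior algebra of covectors. -/
abbrev gradedPart (N r : ℕ) : Submodule ℝ (EA N) := ⋀[ℝ]^r (Fin N → ℝ)

lemma ιMulti_mem_gradedPart {N r : ℕ} (v : Fin r → Fin N → ℝ) :
    ιMulti ℝ r v ∈ gradedPart N r :=
  ιMulti_range ℝ r ⟨v, rfl⟩

lemma gradedPart_induction {N r : ℕ} {C : EA N → Prop}
    (hι : ∀ v : Fin r → Fin N → ℝ, C (ιMulti ℝ r v)) (h0 : C 0)
    (hadd : ∀ x y, C x → C y → C (x + y)) (hsmul : ∀ (c : ℝ) x, C x → C (c • x))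
    {x : EA N} (hx : x ∈ gradedPart N r) : C x := by
  rw [gradedPart, ← ιMulti_span_fixedDegree] at hx
  induction hx using Submodule.span_induction with
  | mem x h => obtain ⟨v, rfl⟩ := h; exact hι v
  | zero => exact h0
  | add x y _ _ hx hy => exact hadd _ _ hx hy
  | smul c x _ hx => exact hsmul _ _ hx

lemma eq_zero_of_mem_gradedPart_succ {N : ℕ} {x : EA N} (hx : x ∈ gradedPart N (N + 1)) :
    x = 0 := by
  refine gradedPart_induction (C := fun x => x = 0) (fun v => ?_) rfl ?_ ?_ hx
  · refine AlternatingMap.map_linearDependent (ιMulti ℝ (N + 1)) v fun h => ?_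
    have := h.fintype_card_le_finrank
    simp at this
  · rintro x y rfl rfl
    simp
  · rintro c x rfl
    simp

lemma mul_mem_gradedPart {N r s : ℕ} {x y : EA N} (hx : x ∈ gradedPart N r)
    (hy : y ∈ gradedPart N s) : x * y ∈ gradedPart N (r + s) := by
  rw [gradedPart, exteriorPower, pow_add]
  exact Submodule.mul_mem_mul hx hy

lemma ι_mem_gradedPart {N : ℕ} (v : Fin N → ℝ) : ι ℝ v ∈ gradedPart N 1 := by
  rw [gradedPart, exteriorPower, pow_one]
  exact ⟨v, rfl⟩

lemma toEA_mem_gradedPart {N p : ℕ} (a : (Fin p → Fin N) → ℝ) : toEA a ∈ gradedPart N p :=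
  Submodule.smul_mem _ _ (Submodule.sum_mem _ fun _ _ =>
    Submodule.smul_mem _ _ (ιMulti_mem_gradedPart _))

lemma pow_mem_gradedPart {N : ℕ} {w : EA N} (hw : w ∈ gradedPart N 2) (m : ℕ) :
    w ^ m ∈ gradedPart N (2 * m) := by
  rw [gradedPart, exteriorPower, pow_mul]
  exact Submodule.pow_mem_pow _ hw m

lemma ctr_mem_gradedPart {N r : ℕ} (d : Module.Dual ℝ (Fin N → ℝ)) {x : EA N}
    (hx : x ∈ gradedPart N (r + 1)) : ctr d x ∈ gradedPart N r := by
  refine gradedPart_induction (C := fun x => ctr d x ∈ gradedPart N r) (fun v => ?_) ?_ ?_ ?_ hx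
  · rw [ctr_ιMulti]
    exact Submodule.sum_mem _ fun _ _ => Submodule.smul_mem _ _ (ιMulti_mem_gradedPart _)
  · rw [map_zero]
    exact Submodule.zero_mem _
  · intro x y hx hy
    rw [map_add]
    exact Submodule.add_mem _ hx hy
  · intro c x hx
    rw [map_smul]
    exact Submodule.smul_mem _ _ hx

lemma ctr_ιMulti_eq_zero {N r : ℕ} {d : Module.Dual ℝ (Fin N → ℝ)} {v : Fin r → Fin N → ℝ}
    (h : ∀ t, d (v t) = 0) : ctr d (ιMulti ℝ r v) = 0 := by
  cases r with
  | zero => rw [ιMulti_zero_apply, ctr_one]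
  | succ r =>
    rw [ctr_ιMulti]
    exact Finset.sum_eq_zero fun t _ => by rw [h t, mul_zero, zero_smul]

lemma ι_mul_ι_comm {N : ℕ} (u v : Fin N → ℝ) : ι ℝ u * ι ℝ v = -(ι ℝ v * ι ℝ u) :=
  eq_neg_of_add_eq_zero_left (ι_add_mul_swap u v)

/-- The coefficient matrix of a component array of degree two. -/
abbrev arrMat {N : ℕ} (a : (Fin 2 → Fin N) → ℝ) : Matrix (Fin N) (Fin N) ℝ :=
  Matrix.of fun i j => a ![i, j]

lemma AltArr.swap {N : ℕ} {a : (Fin 2 → Fin N) → ℝ} (h : AltArr a) (i j : Fin N) :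
    a ![j, i] = -a ![i, j] := by
  have h1 := h.1 ![i, j] (Equiv.swap 0 1)
  rw [Equiv.Perm.sign_swap (by decide)] at h1
  have h2 : ![i, j] ∘ Equiv.swap (0 : Fin 2) 1 = ![j, i] := by
    ext t
    fin_cases t <;> simp
  rw [h2] at h1
  simpa using h1

lemma AltArr.arrMat_transpose {N : ℕ} {a : (Fin 2 → Fin N) → ℝ} (h : AltArr a) :
    (arrMat a)ᵀ = -arrMat a := by
  ext i j
  exact h.swap i j

lemma toEA_two {N : ℕ} (a : (Fin 2 → Fin N) → ℝ) :
    toEA a = (2 : ℝ)⁻¹ • ∑ i, ι ℝ (Pi.single i 1 : Fin N → ℝ) * ι ℝ (arrMat a i) := by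
  unfold toEA
  congr 1
  rw [← (finTwoArrowEquiv (Fin N)).symm.sum_comp, Fintype.sum_prod_type]
  refine Finset.sum_congr rfl fun i _ => ?_
  conv_rhs => rw [pi_eq_sum_univ' (arrMat a i), map_sum, Finset.mul_sum]
  refine Finset.sum_congr rfl fun j _ => ?_
  rw [map_smul, mul_smul_comm]
  simp [finTwoArrowEquiv, ιMulti_succ_apply, Matrix.vecTail]

lemma commute_toEA_two {N : ℕ} (a : (Fin 2 → Fin N) → ℝ) (x : EA N) : Commute (toEA a) x := by
  have h2 : ∀ u v z : Fin N → ℝ, Commute (ι ℝ u * ι ℝ v) (ι ℝ z) := by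
    intro u v z
    change _ * _ = _ * _
    rw [mul_assoc, ι_mul_ι_comm v z, mul_neg, ← mul_assoc, ι_mul_ι_comm u z, neg_mul, neg_neg,
      mul_assoc]
  have h1 : ∀ z, Commute (toEA a) (ι ℝ z) := by
    intro z
    rw [toEA_two]
    exact Commute.smul_left (Commute.sum_left _ _ _ fun i _ => h2 _ _ _) _
  induction x using ExteriorAlgebra.induction with
  | algebraMap r => exact (Algebra.commutes r _).symm
  | ι z => exact h1 z
  | mul a b ha hb => exact ha.mul_right hb
  | add a b ha hb => exact ha.add_right hb

lemma ctr_toEA_two_mul {N : ℕ} {a : (Fin 2 → Fin N) → ℝ} (ha : AltArr a) (u : Fin N → ℝ)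
    (x : EA N) :
    ctr (dotDual u) (toEA a * x) = ι ℝ (u ᵥ* arrMat a) * x + toEA a * ctr (dotDual u) x := by
  have h1 : ι ℝ (u ᵥ* arrMat a) = ∑ i, u i • ι ℝ (arrMat a i) := by
    rw [Matrix.vecMul_eq_sum, map_sum]
    simp only [map_smul]
  have h2 : ι ℝ (u ᵥ* arrMat a)
      = -∑ i, (u ⬝ᵥ arrMat a i) • ι ℝ (Pi.single i 1 : Fin N → ℝ) := by
    conv_lhs => rw [pi_eq_sum_univ' (u ᵥ* arrMat a), map_sum]
    rw [← Finset.sum_neg_distrib]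
    refine Finset.sum_congr rfl fun i _ => ?_
    rw [map_smul, ← neg_smul]
    congr 1
    simp only [Matrix.vecMul, dotProduct, Matrix.of_apply, ← Finset.sum_neg_distrib]
    exact Finset.sum_congr rfl fun j _ => by rw [ha.swap i j]; ring
  have h3 : ι ℝ (u ᵥ* arrMat a) = (2 : ℝ)⁻¹ • (∑ i, u i • ι ℝ (arrMat a i)
      - ∑ i, (u ⬝ᵥ arrMat a i) • ι ℝ (Pi.single i 1 : Fin N → ℝ)) := by
    rw [← h1, sub_eq_add_neg, ← h2, ← two_smul ℝ, smul_smul]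
    norm_num
  rw [h3, toEA_two]
  simp only [smul_mul_assoc, map_smul, Finset.sum_mul, map_sum, mul_assoc, ctr_ι_mul,
    dotDual_apply, dotProduct_single, mul_one, ← smul_add, sub_mul, ← Finset.sum_add_distrib,
    ← Finset.sum_sub_distrib]
  congr 1
  refine Finset.sum_congr rfl fun i _ => ?_
  rw [mul_sub, mul_smul_comm]
  abel

/-- The divided power `w^p / p!`. -/
def divPow {N : ℕ} (w : EA N) (p : ℕ) : EA N := (p.factorial : ℝ)⁻¹ • w ^ p

lemma mul_divPow {N : ℕ} (w : EA N) (p : ℕ) :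
    w * divPow w p = ((p : ℝ) + 1) • divPow w (p + 1) := by
  unfold divPow
  rw [mul_smul_comm, smul_smul, ← pow_succ', Nat.factorial_succ]
  congr 1
  have := Nat.factorial_ne_zero p
  have : (p : ℝ) + 1 ≠ 0 := by positivity
  push_cast
  field_simp

/-- Pointwise data of an almost symplectic form `w` and its bivector `l`. -/
structure SympPair {N : ℕ} (w l : (Fin 2 → Fin N) → ℝ) : Prop where
  alt_form : AltArr w
  alt_bivector : AltArr l
  mul_eq : arrMat l * arrMat w = -1

/-- The functional `v ↦ l(β, v)`. -/
abbrev hamDual {N : ℕ} (l : (Fin 2 → Fin N) → ℝ) (β : Fin N → ℝ) : Module.Dual ℝ (Fin N → ℝ) :=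
  dotDual (β ᵥ* arrMat l)

lemma hamDual_apply {N : ℕ} (l : (Fin 2 → Fin N) → ℝ) (β v : Fin N → ℝ) :
    hamDual l β v = β ⬝ᵥ (arrMat l *ᵥ v) := by
  rw [hamDual, dotDual_apply, Matrix.dotProduct_mulVec]

lemma SympPair.ctr_mul {N : ℕ} {w l : (Fin 2 → Fin N) → ℝ} (h : SympPair w l)
    (β : Fin N → ℝ) (x : EA N) :
    ctr (hamDual l β) (toEA w * x) = -(ι ℝ β * x) + toEA w * ctr (hamDual l β) x := by
  rw [ctr_toEA_two_mul h.alt_form, Matrix.vecMul_vecMul, h.mul_eq, Matrix.vecMul_neg,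
    Matrix.vecMul_one, map_neg, neg_mul]

lemma SympPair.ctr_pow_mul {N : ℕ} {w l : (Fin 2 → Fin N) → ℝ} (h : SympPair w l)
    (β : Fin N → ℝ) (p : ℕ) (x : EA N) :
    ctr (hamDual l β) (toEA w ^ (p + 1) * x)
      = -((p + 1 : ℝ) • (ι ℝ β * toEA w ^ p * x)) + toEA w ^ (p + 1) * ctr (hamDual l β) x := by
  induction p generalizing x with
  | zero => simp [h.ctr_mul]
  | succ p ih =>
    have hc := (commute_toEA_two w (ι ℝ β)).eq
    rw [pow_succ' _ (p + 1), mul_assoc, h.ctr_mul, ih, mul_add, mul_neg, mul_smul_comm]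
    have e1 : toEA w * (ι ℝ β * toEA w ^ p * x) = ι ℝ β * toEA w ^ (p + 1) * x := by
      rw [← mul_assoc, ← mul_assoc, hc, pow_succ', mul_assoc (ι ℝ β)]
    rw [e1, ← mul_assoc (ι ℝ β), ← mul_assoc (toEA w) (toEA w ^ (p + 1))]
    push_cast
    module

lemma SympPair.ι_mul_divPow {N : ℕ} {w l : (Fin 2 → Fin N) → ℝ} (h : SympPair w l)
    (β : Fin N → ℝ) {p r : ℕ} (hr : r + 2 * (p + 1) = N + 1) {ρ : EA N}
    (hρ : ρ ∈ gradedPart N r) :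
    ι ℝ β * ρ * divPow (toEA w) p = ctr (hamDual l β) ρ * divPow (toEA w) (p + 1) := by
  have h0 : toEA w ^ (p + 1) * ρ = 0 := by
    refine eq_zero_of_mem_gradedPart_succ ?_
    rw [← hr, add_comm]
    exact mul_mem_gradedPart (pow_mem_gradedPart (toEA_mem_gradedPart w) _) hρ
  have h1 := h.ctr_pow_mul β p ρ
  rw [h0, map_zero] at h1
  have h2 : toEA w ^ (p + 1) * ctr (hamDual l β) ρ = (p + 1 : ℝ) • (ι ℝ β * toEA w ^ p * ρ) :=
    (neg_add_eq_zero.1 h1.symm).symm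
  unfold divPow
  rw [mul_smul_comm, mul_smul_comm,
    ← ((commute_toEA_two w (ctr (hamDual l β) ρ)).pow_left (p + 1)).eq, h2, smul_smul, mul_assoc, ← ((commute_toEA_two w ρ).pow_left p).eq, Nat.factorial_succ, mul_assoc]
  congr 1
  have := Nat.factorial_ne_zero p
  have : (p : ℝ) + 1 ≠ 0 := by positivity
  push_cast
  field_simp

/-- The pairing of an element of the exterior algebra with `l^m / m!`. -/
def pairPow {N : ℕ} (l : (Fin 2 → Fin N) → ℝ) (m : ℕ) : EA N →ₗ[ℝ] ℝ :=
  ((-1 : ℝ) ^ m * (m.factorial : ℝ)⁻¹) • (scal.toLinearMap ∘ₗ polyCtr (toEA l) ^ m)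

lemma pairPow_apply {N : ℕ} (l : (Fin 2 → Fin N) → ℝ) (m : ℕ) (x : EA N) :
    pairPow l m x = (-1 : ℝ) ^ m * (m.factorial : ℝ)⁻¹ * scal ((polyCtr (toEA l) ^ m) x) := rfl

lemma polyCtr_two_ι_mul {N : ℕ} {l : (Fin 2 → Fin N) → ℝ} (hl : AltArr l) (β : Fin N → ℝ)
    (x : EA N) :
    polyCtr (toEA l) (ι ℝ β * x) = ι ℝ β * polyCtr (toEA l) x - ctr (hamDual l β) x := by
  have h1 : hamDual l β = ∑ i, β i • dotDual (arrMat l i) := by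
    rw [hamDual, Matrix.vecMul_eq_sum, map_sum]
    simp only [map_smul]
  have hsum : ∀ (c : Fin N → ℝ) (d : Fin N → Module.Dual ℝ (Fin N → ℝ)),
      ctr (∑ i, c i • d i) x = ∑ i, c i • ctr (d i) x := by
    intro c d
    change CliffordAlgebra.contractLeft (Q := (0 : QuadraticForm ℝ (Fin N → ℝ))) _ x = _
    rw [map_sum, LinearMap.sum_apply]
    exact Finset.sum_congr rfl fun i _ => by rw [map_smul]; rfl
  have h2 : hamDual l β = ∑ i, (-(arrMat l i ⬝ᵥ β)) • dotDual (Pi.single i 1 : Fin N → ℝ) := by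
    rw [hamDual, pi_eq_sum_univ' (β ᵥ* arrMat l), map_sum]
    refine Finset.sum_congr rfl fun i _ => ?_
    rw [map_smul]
    congr 1
    simp only [Matrix.vecMul, dotProduct, Matrix.of_apply, ← Finset.sum_neg_distrib]
    exact Finset.sum_congr rfl fun j _ => by rw [hl.swap i j]; ring
  have h3 : ctr (hamDual l β) x = (2 : ℝ)⁻¹ • (∑ i, β i • ctr (dotDual (arrMat l i)) x
      + ∑ i, (-(arrMat l i ⬝ᵥ β)) • ctr (dotDual (Pi.single i 1 : Fin N → ℝ)) x) := by
    rw [← hsum, ← hsum, ← h1, ← h2, ← two_smul ℝ, smul_smul]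
    norm_num
  rw [h3, toEA_two]
  simp only [map_smul, map_sum, map_mul, polyCtr_ι, LinearMap.smul_apply, LinearMap.sum_apply,
    Module.End.mul_apply, ctr_ι_mul, map_sub, mul_smul_comm, ← smul_sub, Finset.mul_sum,
    ← Finset.sum_add_distrib, ← Finset.sum_sub_distrib, dotDual_apply, single_dotProduct, one_mul]
  congr 1
  refine Finset.sum_congr rfl fun i _ => ?_
  module

lemma pairPow_succ_ι_mul {N : ℕ} {l : (Fin 2 → Fin N) → ℝ} (hl : AltArr l) (β : Fin N → ℝ)
    (m : ℕ) (x : EA N) :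
    pairPow l (m + 1) (ι ℝ β * x) = pairPow l m (ctr (hamDual l β) x) := by
  have hcomm : ∀ y, polyCtr (toEA l) (ctr (hamDual l β) y)
      = ctr (hamDual l β) (polyCtr (toEA l) y) := by
    intro y
    rw [← polyCtr_ι, ← Module.End.mul_apply, ← map_mul, (commute_toEA_two l _).eq, map_mul]
    rfl
  have hpow : ∀ (m : ℕ) y, (polyCtr (toEA l) ^ m) (ctr (hamDual l β) y)
      = ctr (hamDual l β) ((polyCtr (toEA l) ^ m) y) := by
    intro m
    induction m with
    | zero => intro y; simp
    | succ m ih =>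
      intro y
      rw [pow_succ', Module.End.mul_apply, ih, hcomm]
      rfl
  have hstep : ∀ (m : ℕ) y, polyCtr (toEA l) ((polyCtr (toEA l) ^ m) y)
      = (polyCtr (toEA l) ^ (m + 1)) y := fun m y => by rw [pow_succ', Module.End.mul_apply]
  have key : ∀ (m : ℕ), (polyCtr (toEA l) ^ (m + 1)) (ι ℝ β * x)
      = ι ℝ β * (polyCtr (toEA l) ^ (m + 1)) x
        - (m + 1 : ℝ) • (polyCtr (toEA l) ^ m) (ctr (hamDual l β) x) := by
    intro m
    induction m with
    | zero => simp [polyCtr_two_ι_mul hl]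
    | succ m ih =>
      rw [← hstep (m + 1) (ι ℝ β * x), ih, map_sub, polyCtr_two_ι_mul hl, map_smul,
        hstep, hstep, ← hpow]
      push_cast
      module
  rw [pairPow_apply, pairPow_apply, key, map_sub, scal_ι_mul, map_smul, Nat.factorial_succ,
    pow_succ, smul_eq_mul]
  have := Nat.factorial_ne_zero m
  have : (m : ℝ) + 1 ≠ 0 := by positivity
  push_cast
  field_simp
  ring

lemma SympPair.mul_divPow_eq {n : ℕ} {w l : (Fin 2 → Fin (2 * n)) → ℝ} (h : SympPair w l)
    (m : ℕ) (hm : m ≤ n) : ∀ {ρ : EA (2 * n)}, ρ ∈ gradedPart (2 * n) (2 * m) →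
      ρ * divPow (toEA w) (n - m) = pairPow l m ρ • divPow (toEA w) n := by
  induction m with
  | zero =>
    intro ρ hρ
    rw [gradedPart, exteriorPower, mul_zero, pow_zero] at hρ
    obtain ⟨c, rfl⟩ := Submodule.mem_one.1 hρ
    rw [pairPow_apply, pow_zero, pow_zero, Nat.sub_zero, ← Algebra.smul_def, Module.End.one_apply,
      AlgHom.commutes]
    simp
  | succ m ih =>
    intro ρ hρ
    refine gradedPart_induction (C := fun ρ => ρ * divPow (toEA w) (n - (m + 1))
      = pairPow l (m + 1) ρ • divPow (toEA w) n) (fun v => ?_) ?_ ?_ ?_ hρ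
    · change ιMulti ℝ (2 * m + 1 + 1) v * _ = pairPow l (m + 1) (ιMulti ℝ (2 * m + 1 + 1) v) • _
      rw [ιMulti_succ_apply, h.ι_mul_divPow (v 0) (r := 2 * m + 1) (by omega)
        (ιMulti_mem_gradedPart _), show n - (m + 1) + 1 = n - m by omega,
        ih (by omega) (ctr_mem_gradedPart _ (ιMulti_mem_gradedPart _)),
        pairPow_succ_ι_mul h.alt_bivector]
    · simp
    · intro x y hx hy
      rw [add_mul, hx, hy, map_add, add_smul]
    · intro c x hx
      rw [smul_mul_assoc, hx, map_smul, smul_eq_mul, mul_smul]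

/-- The matrix of the bivector `l^#(s)`. -/
abbrev sharpMat {N : ℕ} (l s : (Fin 2 → Fin N) → ℝ) : Matrix (Fin N) (Fin N) ℝ :=
  (arrMat l)ᵀ * arrMat s * arrMat l

lemma dotProduct_sharpMat_mulVec {N : ℕ} {l s : (Fin 2 → Fin N) → ℝ} (hs : AltArr s)
    (β₁ β₂ : Fin N → ℝ) :
    β₁ ⬝ᵥ (sharpMat l s *ᵥ β₂)
      = -((arrMat s *ᵥ (arrMat l *ᵥ β₁)) ⬝ᵥ (arrMat l *ᵥ β₂)) := by
  rw [sharpMat, ← Matrix.mulVec_mulVec, ← Matrix.mulVec_mulVec, Matrix.dotProduct_mulVec,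
    Matrix.vecMul_transpose, Matrix.dotProduct_mulVec, ← Matrix.mulVec_transpose,
    hs.arrMat_transpose, Matrix.neg_mulVec, neg_dotProduct]

/-- Contraction of `s ∧ β₁ ∧ β₂ ∧ α` when `α` is annihilated by `s ∘ l`. -/
lemma SympPair.toEA_mul_mul_divPow {N : ℕ} {w l s : (Fin 2 → Fin N) → ℝ} (h : SympPair w l)
    (hs : AltArr s) {r p : ℕ} (hr : r + 2 * (p + 2) = N) (v : Fin r → Fin N → ℝ)
    (hv : ∀ t, arrMat s *ᵥ (arrMat l *ᵥ v t) = 0) (β₁ β₂ : Fin N → ℝ) :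
    toEA s * (ι ℝ β₁ * (ι ℝ β₂ * ιMulti ℝ r v)) * divPow (toEA w) p
      = -(((2 : ℝ)⁻¹ * (arrMat s * arrMat l).trace) •
          (ι ℝ β₁ * (ι ℝ β₂ * ιMulti ℝ r v) * divPow (toEA w) (p + 1)))
        - (β₁ ⬝ᵥ (sharpMat l s *ᵥ β₂)) • (ιMulti ℝ r v * divPow (toEA w) (p + 2)) := by
  set α := ιMulti ℝ r v with hα
  have hαm : α ∈ gradedPart N r := ιMulti_mem_gradedPart v
  have hrow : ∀ i, ctr (hamDual l (arrMat s i)) α = 0 := fun i => ctr_ιMulti_eq_zero fun t => by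
    rw [hamDual_apply]
    exact congrFun (hv t) i
  have htv : ∀ β, ctr (hamDual l (arrMat s *ᵥ (arrMat l *ᵥ β))) α = 0 :=
    fun β => ctr_ιMulti_eq_zero fun t => by
      rw [hamDual_apply, dotProduct_comm, Matrix.dotProduct_mulVec, ← Matrix.mulVec_transpose,
        hs.arrMat_transpose, Matrix.neg_mulVec, hv, neg_zero, zero_dotProduct]
  have hsum : toEA s = -((2 : ℝ)⁻¹ •
      ∑ i, ι ℝ (arrMat s i) * ι ℝ (Pi.single i 1 : Fin N → ℝ)) := by
    rw [toEA_two, ← smul_neg, ← Finset.sum_neg_distrib]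
    congr 1
    exact Finset.sum_congr rfl fun i _ => ι_mul_ι_comm _ _
  have hmem : ∀ β, ι ℝ β * α ∈ gradedPart N (1 + r) :=
    fun β => mul_mem_gradedPart (ι_mem_gradedPart _) hαm
  have hterm : ∀ i, ι ℝ (arrMat s i) * (ι ℝ (Pi.single i 1 : Fin N → ℝ) *
        (ι ℝ β₁ * (ι ℝ β₂ * α))) * divPow (toEA w) p
      = (arrMat s * arrMat l) i i • (ι ℝ β₁ * (ι ℝ β₂ * α) * divPow (toEA w) (p + 1))
        - (arrMat s *ᵥ (arrMat l *ᵥ β₁)) i •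
            (ι ℝ (Pi.single i 1 : Fin N → ℝ) * (ι ℝ β₂ * α) * divPow (toEA w) (p + 1))
        + (arrMat s *ᵥ (arrMat l *ᵥ β₂)) i •
            (ι ℝ (Pi.single i 1 : Fin N → ℝ) * (ι ℝ β₁ * α) * divPow (toEA w) (p + 1)) := by
    intro i
    rw [h.ι_mul_divPow (arrMat s i) (r := 1 + (1 + (1 + r))) (by omega)
      (mul_mem_gradedPart (ι_mem_gradedPart _) (mul_mem_gradedPart (ι_mem_gradedPart _) (hmem _))),
      ctr_ι_mul, ctr_ι_mul, ctr_ι_mul, hrow, hamDual_apply, hamDual_apply, hamDual_apply]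
    have e1 : arrMat s i ⬝ᵥ (arrMat l *ᵥ Pi.single i 1) = (arrMat s * arrMat l) i i := by
      rw [Matrix.mulVec_single_one]
      rfl
    rw [e1]
    simp only [mul_zero, sub_zero, mul_sub, sub_mul, mul_smul_comm, smul_mul_assoc, Matrix.mulVec]
    abel
  have hvec : ∀ u : Fin N → ℝ, ∀ x : EA N,
      ∑ i, u i • (ι ℝ (Pi.single i 1 : Fin N → ℝ) * x * divPow (toEA w) (p + 1))
        = ι ℝ u * x * divPow (toEA w) (p + 1) := by
    intro u x
    conv_rhs => rw [pi_eq_sum_univ' u, map_sum, Finset.sum_mul, Finset.sum_mul]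
    exact Finset.sum_congr rfl fun i _ => by rw [map_smul, smul_mul_assoc, smul_mul_assoc]
  have hlast : ∀ β β' : Fin N → ℝ, ι ℝ (arrMat s *ᵥ (arrMat l *ᵥ β)) * (ι ℝ β' * α) *
      divPow (toEA w) (p + 1)
      = -((β ⬝ᵥ (sharpMat l s *ᵥ β')) • (α * divPow (toEA w) (p + 2))) := by
    intro β β'
    rw [h.ι_mul_divPow _ (r := 1 + r) (by omega) (hmem _), ctr_ι_mul, htv, mul_zero, sub_zero,
      hamDual_apply, dotProduct_sharpMat_mulVec hs, smul_mul_assoc, neg_smul, neg_neg]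
  have hanti : β₂ ⬝ᵥ (sharpMat l s *ᵥ β₁) = -(β₁ ⬝ᵥ (sharpMat l s *ᵥ β₂)) := by
    rw [dotProduct_sharpMat_mulVec hs, dotProduct_comm, Matrix.dotProduct_mulVec,
      ← Matrix.mulVec_transpose, hs.arrMat_transpose, dotProduct_sharpMat_mulVec hs,
      Matrix.neg_mulVec, neg_dotProduct]
  rw [hsum, neg_mul, neg_mul, smul_mul_assoc, smul_mul_assoc, Finset.sum_mul, Finset.sum_mul]
  simp only [mul_assoc (ι ℝ (arrMat s _)) (ι ℝ (Pi.single _ 1 : Fin N → ℝ)), hterm]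
  rw [Finset.sum_add_distrib, Finset.sum_sub_distrib, hvec, hvec, hlast, hlast, hanti,
    ← Finset.sum_smul]
  change -((2 : ℝ)⁻¹ • ((arrMat s * arrMat l).trace • _ - _ + _)) = _
  module

/-- The exterior algebra form of the bracket formula. -/
theorem SympPair.core_identity {n k : ℕ} (hk : 2 ≤ k) (hkn : k ≤ n)
    {w l s : (Fin 2 → Fin (2 * n)) → ℝ} (h : SympPair w l) (hs : AltArr s)
    (v : Fin (2 * (n - k)) → Fin (2 * n) → ℝ)
    (hv : ∀ t, arrMat s *ᵥ (arrMat l *ᵥ v t) = 0) (β₁ β₂ : Fin (2 * n) → ℝ) :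
    ι ℝ β₁ * (ι ℝ β₂ * ((toEA s +
        ((2 : ℝ)⁻¹ * (arrMat s * arrMat l).trace / ((k : ℝ) - 1)) • toEA w) *
          divPow (toEA w) (k - 2) * ιMulti ℝ _ v))
      = -((pairPow l (n - k) (ιMulti ℝ _ v) * (β₁ ⬝ᵥ (sharpMat l s *ᵥ β₂))) •
          divPow (toEA w) n) := by
  obtain ⟨j, rfl⟩ := Nat.exists_eq_add_of_le' hk
  have hc : ∀ (p : ℕ) (x : EA (2 * n)), divPow (toEA w) p * x = x * divPow (toEA w) p := by
    intro p x
    unfold divPow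
    rw [smul_mul_assoc, mul_smul_comm, ((commute_toEA_two w x).pow_left p).eq]
  have hα := h.mul_divPow_eq (n - (j + 2)) (by omega) (ιMulti_mem_gradedPart v)
  rw [show n - (n - (j + 2)) = j + 2 by omega] at hα
  have hmain := h.toEA_mul_mul_divPow hs (p := j) (by omega) v hv β₁ β₂
  rw [hα, smul_smul] at hmain
  have hw : ((j + 2 : ℕ) : ℝ) - 1 ≠ 0 := by
    push_cast
    have : (0 : ℝ) ≤ j := j.cast_nonneg
    linarith
  have h2 : ι ℝ β₁ * (ι ℝ β₂ * (toEA w * divPow (toEA w) j * ιMulti ℝ _ v))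
      = (((j + 2 : ℕ) : ℝ) - 1) •
        (ι ℝ β₁ * (ι ℝ β₂ * ιMulti ℝ _ v) * divPow (toEA w) (j + 1)) := by
    rw [mul_divPow, smul_mul_assoc, mul_smul_comm, mul_smul_comm, hc, mul_assoc, mul_assoc]
    congr 1
    push_cast
    ring
  have h1 : ι ℝ β₁ * (ι ℝ β₂ * (toEA s * divPow (toEA w) j * ιMulti ℝ _ v))
      = toEA s * (ι ℝ β₁ * (ι ℝ β₂ * ιMulti ℝ _ v)) * divPow (toEA w) j := by
    have e := fun u => (commute_toEA_two s (ι ℝ u)).eq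
    rw [mul_assoc (toEA s), hc, ← mul_assoc (ι ℝ β₂), ← e β₂, mul_assoc (toEA s),
      ← mul_assoc (ι ℝ β₁), ← e β₁, mul_assoc, mul_assoc, mul_assoc, mul_assoc]
  rw [show j + 2 - 2 = j by omega, add_mul, add_mul, mul_add, mul_add, smul_mul_assoc,
    smul_mul_assoc, mul_smul_comm, mul_smul_comm, h1, h2, hmain, smul_smul, div_mul_cancel₀ _ hw]
  module

lemma AlmostSymp.sympPair {N : ℕ} {ω₀ Λ₀ : Form N 2} {M : Set (Pt N)} (h : AlmostSymp ω₀ Λ₀ M)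
    {x : Pt N} (hx : x ∈ M) : SympPair (ω₀ x) (Λ₀ x) where
  alt_form := h.1.1 x hx
  alt_bivector := h.2.1.1 x hx
  mul_eq := by
    have h1 : -mat2 ω₀ x * mat2 Λ₀ x = 1 := by rw [neg_mul, h.2.2 x hx, neg_neg]
    have h2 := mul_eq_one_comm.1 h1
    rw [mul_neg] at h2
    exact neg_eq_iff_eq_neg.1 h2

lemma sharpF_two {N : ℕ} (Λ σ : Form N 2) (x : Pt N) (J : Fin 2 → Fin N) :
    sharpF Λ 2 σ x J = sharpMat (Λ x) (σ x) (J 0) (J 1) := by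
  unfold sharpF sharpMat
  rw [← (finTwoArrowEquiv (Fin N)).symm.sum_comp, Fintype.sum_prod_type]
  simp only [Matrix.mul_apply, Matrix.transpose_apply, Matrix.of_apply, Finset.sum_mul]
  rw [Finset.sum_comm, Even.neg_one_pow (by decide), one_mul]
  refine Finset.sum_congr rfl fun j _ => Finset.sum_congr rfl fun i _ => ?_
  simp [finTwoArrowEquiv, Fin.prod_univ_two]
  ring

lemma mat2_sharpF {N : ℕ} (Λ σ : Form N 2) (x : Pt N) :
    mat2 (sharpF Λ 2 σ) x = sharpMat (Λ x) (σ x) := by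
  ext i j
  exact sharpF_two Λ σ x ![i, j]

lemma braF_eq {N : ℕ} (Λ : Form N 2) (g h : Pt N → ℝ) (x : Pt N) :
    braF Λ g h x = grad g x ⬝ᵥ (mat2 Λ x *ᵥ grad h x) := by
  simp only [braF, dotProduct, Matrix.mulVec, Finset.mul_sum, grad, mat2, Matrix.of_apply]
  exact Finset.sum_congr rfl fun i _ => Finset.sum_congr rfl fun j _ => by ring

lemma pairPow_eq {N : ℕ} (Λ : Form N 2) (m : ℕ) (x : Pt N) (y : EA N) :
    pairPow (Λ x) m y = (-1 : ℝ) ^ m * scal (polyCtr (toEA (volF m Λ x)) y) := by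
  have h : toEA (volF m Λ x) = (m.factorial : ℝ)⁻¹ • toEA (Λ x) ^ m := by
    rw [← toEA_wpow, ← toEA_smul]
    rfl
  rw [pairPow_apply, h, map_smul, map_pow, LinearMap.smul_apply, map_smul, smul_eq_mul, mul_assoc]

lemma neg_one_pow_triangle (m : ℕ) : (-1 : ℝ) ^ (2 * m * (2 * m - 1) / 2) = (-1) ^ m := by
  have h : 2 * m * (2 * m - 1) / 2 = m * (2 * m - 1) := by
    rw [mul_assoc, Nat.mul_div_cancel_left _ two_pos]
  rw [h]
  cases m with
  | zero => simp
  | succ m =>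
    rw [mul_comm, pow_mul, Odd.neg_one_pow ⟨m, by omega⟩]

lemma pairF_volF {N : ℕ} (Λ : Form N 2) (m : ℕ) (η : Form N (2 * m)) (x : Pt N) :
    pairF η (volF m Λ) x = pairPow (Λ x) m (toEA (η x)) := by
  rw [pairPow_eq, scal_polyCtr_toEA (altArr_volF m Λ x), neg_one_pow_triangle, ← mul_assoc,
    ← mul_pow]
  simp [pairF]

lemma fEven_eq {n k : ℕ} (Λ₀ : Form (2 * n) 2) (f : Fin (2 * (n - k)) → Pt (2 * n) → ℝ)
    (x : Pt (2 * n)) :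
    fEven Λ₀ f x = pairPow (Λ₀ x) (n - k) (ιMulti ℝ _ fun t => grad (f t) x) := by
  rw [← toEA_wedgeList _ (fun i => dF (f i)) _ x fun _ _ => rfl, ← pairF_volF]
  rfl

lemma toEA_volF {N : ℕ} (ω : Form N 2) (m : ℕ) (x : Pt N) :
    toEA (volF m ω x) = divPow (toEA (ω x)) m := by
  unfold divPow
  rw [← toEA_wpow, ← toEA_smul]
  rfl

lemma gEven_eq {N : ℕ} {Λ₀ σ : Form N 2} {x : Pt N} (hΛ : AltArr (Λ₀ x)) :
    gEven Λ₀ σ x = (2 : ℝ)⁻¹ * (arrMat (σ x) * arrMat (Λ₀ x)).trace := by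
  unfold gEven pairF
  rw [← (finTwoArrowEquiv (Fin N)).symm.sum_comp, Fintype.sum_prod_type]
  simp only [Matrix.trace, Matrix.diag, Matrix.mul_apply, Matrix.of_apply]
  rw [← mul_neg, ← Finset.sum_neg_distrib]
  simp only [← Finset.sum_neg_distrib]
  congr 1
  refine Finset.sum_congr rfl fun i _ => Finset.sum_congr rfl fun j _ => ?_
  rw [hΛ.swap i j]
  simp [finTwoArrowEquiv]

lemma toEA_coreForm {n k : ℕ} {ω₀ Λ₀ : Form (2 * n) 2} (σ : Form (2 * n) 2)
    (f : Fin (2 * (n - k)) → Pt (2 * n) → ℝ) {x : Pt (2 * n)} (hΛ : AltArr (Λ₀ x)) :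
    toEA (coreForm k ω₀ Λ₀ σ f x) = (toEA (σ x) +
        ((2 : ℝ)⁻¹ * (arrMat (σ x) * arrMat (Λ₀ x)).trace / ((k : ℝ) - 1)) • toEA (ω₀ x)) *
          divPow (toEA (ω₀ x)) (k - 2) * ιMulti ℝ _ (fun t => grad (f t) x) := by
  rw [coreForm, toEA_wedgeF, toEA_wedgeF, toEA_wedgeList _ (fun i => dF (f i))
    (fun t => grad (f t) x) x fun _ _ => rfl, ← gEven_eq hΛ, ← toEA_volF, ← toEA_smul, ← toEA_add]
  rfl

lemma ne_zero_of_divPow {n : ℕ} {w l : (Fin 2 → Fin (2 * n)) → ℝ} (h : SympPair w l) :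
    divPow (toEA w) n ≠ 0 := by
  intro h0
  have h1 := h.mul_divPow_eq n le_rfl
    (toEA_mem_gradedPart fun I : Fin (2 * n) → Fin (2 * n) => kdet I id)
  rw [h0, smul_zero, Nat.sub_self, divPow, pow_zero, Nat.factorial_zero, Nat.cast_one, inv_one,
    one_smul, mul_one] at h1
  have h2 := toEA_injective (N := 2 * n) (p := 2 * n) (η := fun I => kdet I id)
    (ζ := fun _ => 0 * 0) (altArr_of_perm fun I τ => kdet_comp_perm_left τ I id)
    (altArr_of_perm fun I τ => by simp) (by rw [h1, toEA_smul, zero_smul]) id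
  simp [kdet] at h2
  have h3 : (Matrix.of fun s t : Fin (2 * n) => if s = t then (1 : ℝ) else 0) = 1 := by
    ext s t
    simp [Matrix.one_apply]
  rw [h3, Matrix.det_one] at h2
  exact one_ne_zero h2

lemma SympPair.pairPow_top {n : ℕ} {w l : (Fin 2 → Fin (2 * n)) → ℝ} (h : SympPair w l) :
    pairPow l n (divPow (toEA w) n) = 1 := by
  have h1 := h.mul_divPow_eq n le_rfl (ρ := divPow (toEA w) n)
    (Submodule.smul_mem _ _ (pow_mem_gradedPart (toEA_mem_gradedPart w) n))
  have h2 : divPow (toEA w) (n - n) = 1 := by simp [divPow]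
  rw [h2, mul_one] at h1
  have h3 : (1 - pairPow l n (divPow (toEA w) n)) • divPow (toEA w) n = 0 := by
    rw [sub_smul, one_smul, sub_eq_zero]
    exact h1
  have h4 := (smul_eq_zero.1 h3).resolve_right (ne_zero_of_divPow h)
  linarith

lemma hamV_annihilated {N : ℕ} {Λ₀ σ : Form N 2} {x : Pt N} (hΛ : AltArr (Λ₀ x))
    (hσ : AltArr (σ x)) {f : Pt N → ℝ} (h : ∀ b, ∑ a, σ x ![a, b] * hamV Λ₀ f x a = 0) :
    arrMat (σ x) *ᵥ (arrMat (Λ₀ x) *ᵥ grad f x) = 0 := by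
  have h1 : hamV Λ₀ f x = -(arrMat (Λ₀ x) *ᵥ grad f x) := by
    rw [← Matrix.neg_mulVec, ← hΛ.arrMat_transpose, Matrix.mulVec_transpose]
    ext j
    simp only [hamV, sharpV, Matrix.vecMul, dotProduct, Matrix.of_apply]
    exact Finset.sum_congr rfl fun i _ => mul_comm _ _
  ext b
  have h2 := h b
  rw [h1] at h2
  simp only [Matrix.mulVec, dotProduct, Pi.zero_apply]
  rw [← h2]
  refine Finset.sum_congr rfl fun a _ => ?_
  rw [hσ.swap b a]
  simp only [Matrix.of_apply, Pi.neg_apply, Matrix.mulVec, dotProduct]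
  ring

lemma ιMulti_catIdx' {N q r : ℕ} (hr : r = q + 2) (B : Fin 2 → Fin N) (A : Fin q → Fin N) :
    ιMulti ℝ r (fun s => (Pi.single
        (catIdx' (c := q) (b := r) (fun t => B (Fin.cast (by omega) t)) A s) 1 : Fin N → ℝ))
      = ι ℝ (Pi.single (B 0) 1 : Fin N → ℝ) * (ι ℝ (Pi.single (B 1) 1 : Fin N → ℝ) *
          ιMulti ℝ q fun s => (Pi.single (A s) 1 : Fin N → ℝ)) := by
  subst hr
  have hq : q + 2 - q = 2 := by omega
  rw [ιMulti_succ_apply, ιMulti_succ_apply]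
  have h0 : catIdx' (c := q) (b := q + 2) (fun t => B (Fin.cast (by omega) t)) A 0 = B 0 := by
    unfold catIdx'
    rw [dif_pos (by simp)]
    rfl
  have h1 : catIdx' (c := q) (b := q + 2) (fun t => B (Fin.cast (by omega) t)) A 1 = B 1 := by
    unfold catIdx'
    rw [dif_pos (by simp)]
    rfl
  have h2 : ∀ s : Fin q, catIdx' (c := q) (b := q + 2) (fun t => B (Fin.cast (by omega) t)) A
      s.succ.succ = A s := by
    intro s
    unfold catIdx'
    rw [dif_neg (by simp)]
    congr 1
    ext
    simp
  rw [h0]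
  congr 2
  · exact congrArg (fun j => ι ℝ (Pi.single j 1 : Fin N → ℝ)) h1
  · congr 1
    funext s
    exact congrArg (fun j => (Pi.single j 1 : Fin N → ℝ)) (h2 s)

lemma castF_jF {N q r : ℕ} (hr : r = q + 2) (h : r - q = 2) (η : Form N q) {P : Form N r}
    {x : Pt N} (hP : AltArr (P x)) (B : Fin 2 → Fin N) :
    castF h (jF q r η P) x B = (-1 : ℝ) ^ (r * (r - 1) / 2) *
      scal (polyCtr (toEA (P x)) (ι ℝ (Pi.single (B 0) 1 : Fin N → ℝ) *
        (ι ℝ (Pi.single (B 1) 1 : Fin N → ℝ) * toEA (η x)))) := by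
  have h1 : toEA (η x) = (q.factorial : ℝ)⁻¹ • ∑ I, η x I •
      ιMulti ℝ q fun s => (Pi.single (I s) 1 : Fin N → ℝ) := rfl
  rw [h1]
  simp only [mul_smul_comm, Finset.mul_sum, ← ιMulti_catIdx' hr, map_smul, map_sum,
    scal_polyCtr_toEA_ιMulti hP, smul_eq_mul, castF, jF]
  refine Finset.sum_congr rfl fun A _ => ?_
  have : (-1 : ℝ) ^ (r * (r - 1) / 2) * (-1 : ℝ) ^ (r * (r - 1) / 2) = 1 := by
    rw [← mul_pow]
    simp
  linear_combination (-(q.factorial : ℝ)⁻¹ * (η x A * P x (catIdx' (fun t => B (Fin.cast h t)) A)))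
    * this

section Pointwise

variable {n k : ℕ} {ω₀ Λ₀ σ : Form (2 * n) 2} {f : Fin (2 * (n - k)) → Pt (2 * n) → ℝ}
  {x : Pt (2 * n)}

lemma ι_mul_coreForm (hk : 2 ≤ k) (hkn : k ≤ n) (h : SympPair (ω₀ x) (Λ₀ x))
    (hσ : AltArr (σ x)) (hD : ∀ i b, ∑ a, σ x ![a, b] * hamV Λ₀ (f i) x a = 0)
    (β₁ β₂ : Fin (2 * n) → ℝ) :
    ι ℝ β₁ * (ι ℝ β₂ * toEA (coreForm k ω₀ Λ₀ σ f x))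
      = -((fEven Λ₀ f x * (β₁ ⬝ᵥ (mat2 (sharpF Λ₀ 2 σ) x *ᵥ β₂))) • toEA (volF n ω₀ x)) := by
  rw [toEA_coreForm σ f h.alt_bivector, h.core_identity hk hkn hσ _ fun t =>
    hamV_annihilated h.alt_bivector hσ (hD t), fEven_eq, mat2_sharpF, toEA_volF]

lemma Psi_inv_PhiForm (hk : 2 ≤ k) (hkn : k ≤ n) (h : SympPair (ω₀ x) (Λ₀ x))
    (hσ : AltArr (σ x)) (hD : ∀ i b, ∑ a, σ x ![a, b] * hamV Λ₀ (f i) x a = 0)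
    (hf : fEven Λ₀ f x ≠ 0)
    (hdeg : 2 * n - (2 + 2 * (k - 2) + 2 * (n - k)) = 2) (I : Fin 2 → Fin (2 * n)) :
    castF hdeg (jF (2 + 2 * (k - 2) + 2 * (n - k)) (2 * n) (PhiForm k ω₀ Λ₀ σ f) (volF n Λ₀)) x I
      = sharpF Λ₀ 2 σ x I := by
  have h1 : toEA (PhiForm k ω₀ Λ₀ σ f x) = -(fEven Λ₀ f x)⁻¹ • toEA (coreForm k ω₀ Λ₀ σ f x) := by
    rw [← toEA_smul]
    rfl
  rw [castF_jF (by omega) hdeg _ (altArr_volF n Λ₀ x), neg_one_pow_triangle, ← pairPow_eq, h1,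
    mul_smul_comm, mul_smul_comm, ι_mul_coreForm hk hkn h hσ hD, map_smul, map_neg, map_smul,
    toEA_volF, h.pairPow_top, mat2_sharpF, Matrix.mulVec_single_one, single_dotProduct, sharpF_two]
  simp only [smul_eq_mul, mul_one, one_mul, neg_mul_neg, Matrix.col_apply]
  rw [← mul_assoc, inv_mul_cancel₀ hf, one_mul]

lemma braF_mul_volF (hk : 2 ≤ k) (hkn : k ≤ n) (h : SympPair (ω₀ x) (Λ₀ x))
    (hσ : AltArr (σ x)) (hD : ∀ i b, ∑ a, σ x ![a, b] * hamV Λ₀ (f i) x a = 0)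
    (hf : fEven Λ₀ f x ≠ 0)
    (hdeg : 2 + (2 + 2 * (k - 2) + 2 * (n - k)) = 2 * n) (h₁ h₂ : Pt (2 * n) → ℝ)
    (I : Fin (2 * n) → Fin (2 * n)) :
    braF (sharpF Λ₀ 2 σ) h₁ h₂ x * volF n ω₀ x I
      = -(fEven Λ₀ f x)⁻¹ *
        castF hdeg (wedgeF 2 (2 + 2 * (k - 2) + 2 * (n - k))
          (wedgeF 1 1 (dF h₁) (dF h₂)) (coreForm k ω₀ Λ₀ σ f)) x I := by
  refine toEA_injective (η := fun I => braF (sharpF Λ₀ 2 σ) h₁ h₂ x * volF n ω₀ x I)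
    (ζ := fun I => -(fEven Λ₀ f x)⁻¹ *
        castF hdeg (wedgeF 2 (2 + 2 * (k - 2) + 2 * (n - k))
          (wedgeF 1 1 (dF h₁) (dF h₂)) (coreForm k ω₀ Λ₀ σ f)) x I)
    ((altArr_volF n ω₀ x).const_mul _) ((altArr_castF _ (altArr_wedgeF _ _ _)).const_mul _) ?_ I
  rw [toEA_smul, toEA_smul, toEA_castF, toEA_wedgeF, toEA_wedgeF, toEA_dF, toEA_dF, mul_assoc,
    ι_mul_coreForm hk hkn h hσ hD, smul_neg, neg_smul, neg_neg, smul_smul, ← mul_assoc,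
    inv_mul_cancel₀ hf, one_mul, braF_eq]

lemma casimir_sharpF (h : AltArr (Λ₀ x)) (hσ : AltArr (σ x)) {c : Pt (2 * n) → ℝ}
    (hD : ∀ b, ∑ a, σ x ![a, b] * hamV Λ₀ c x a = 0) (b : Fin (2 * n)) :
    ∑ a, sharpF Λ₀ 2 σ x ![a, b] * grad c x a = 0 := by
  have h1 := hamV_annihilated h hσ hD
  have h2 := dotProduct_sharpMat_mulVec (l := Λ₀ x) hσ (grad c x) (Pi.single b 1)
  rw [h1, zero_dotProduct, neg_zero, Matrix.mulVec_single_one, dotProduct_comm,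
    ← mat2_sharpF] at h2
  exact h2

end Pointwise

lemma rank_sharpF_le {N : ℕ} (Λ σ : Form N 2) (x : Pt N) :
    (mat2 (sharpF Λ 2 σ) x).rank ≤ (mat2 σ x).rank := by
  rw [mat2_sharpF]
  exact (Matrix.rank_mul_le_left _ _).trans (Matrix.rank_mul_le_right _ _)

lemma rank_le_of_dense {N r : ℕ} {σ : Form N 2} {M U : Set (Pt N)} (hM : IsOpen M)
    (hσ : ∀ I, ContinuousOn (fun x => σ x I) M) (hU : M ⊆ closure U)
    (hr : ∀ x ∈ U, (mat2 σ x).rank ≤ r) {x : Pt N} (hx : x ∈ M) : (mat2 σ x).rank ≤ r := by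
  by_contra! hlt
  let T : Pt N → (Fin N → ℝ) →L[ℝ] (Fin N → ℝ) :=
    fun y => LinearMap.toContinuousLinearMap (Matrix.mulVecLin (mat2 σ y))
  have hT : ContinuousAt T x := by
    have hmat : ContinuousAt (mat2 σ) x := by
      refine continuousAt_pi.2 fun i => continuousAt_pi.2 fun j => ?_
      exact (hσ ![i, j]).continuousAt (hM.mem_nhds hx)
    have hlin : Continuous fun A : Matrix (Fin N) (Fin N) ℝ =>
        LinearMap.toContinuousLinearMap (Matrix.mulVecLin A) :=
      ((LinearMap.toContinuousLinearMap (𝕜 := ℝ) (E := Fin N → ℝ) (F' := Fin N → ℝ)).toLinearMap ∘ₗ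
        Matrix.toLin'.toLinearMap).continuous_of_finiteDimensional
    exact hlin.continuousAt.comp hmat
  have hrank : ∀ y, (T y : (Fin N → ℝ) →ₗ[ℝ] (Fin N → ℝ)).rank
      = ((mat2 σ y).rank : Cardinal) := by
    intro y
    rw [Matrix.rank, Module.finrank_eq_rank]
    rfl
  have hopen := isOpen_setOfPred_nat_le_rank (𝕜 := ℝ) (E := Fin N → ℝ) (F := Fin N → ℝ) (r + 1)
  have hev : ∀ᶠ y in nhds x, r + 1 ≤ (mat2 σ y).rank := by
    have h1 : T x ∈ {A : (Fin N → ℝ) →L[ℝ] (Fin N → ℝ) |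
        ((r + 1 : ℕ) : Cardinal) ≤ (A : (Fin N → ℝ) →ₗ[ℝ] (Fin N → ℝ)).rank} := by
      rw [Set.mem_ofPred_eq, hrank]
      exact_mod_cast hlt
    filter_upwards [hT.eventually (hopen.mem_nhds h1)] with y hy
    have hy' : ((r + 1 : ℕ) : Cardinal) ≤ (T y : (Fin N → ℝ) →ₗ[ℝ] (Fin N → ℝ)).rank := hy
    rw [hrank] at hy'
    exact_mod_cast hy'
  obtain ⟨y, hy, hyU⟩ := mem_closure_iff_nhds.1 (hU hx) _ hev
  have := hr y hyU
  have hy' : r + 1 ≤ (mat2 σ y).rank := hy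
  omega

/-- Concatenation of two index blocks. -/
def blk {a b N : ℕ} (h : a + b = N) : Fin a ⊕ Fin b ≃ Fin N :=
  finSumFinEquiv.trans (finCongr h)

lemma blk_inl_val {a b N : ℕ} (h : a + b = N) (s : Fin a) : (blk h (Sum.inl s) : ℕ) = s := by
  simp [blk]

lemma blk_inr_val {a b N : ℕ} (h : a + b = N) (s : Fin b) : (blk h (Sum.inr s) : ℕ) = a + s := by
  simp [blk]

/-- The Levi-Civita symbol of the concatenation of two index blocks. -/
def bdet {a b N : ℕ} (h : a + b = N) (I : Fin a → Fin N) (J : Fin b → Fin N) : ℝ :=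
  kdet (Sum.elim I J) (blk h)

lemma kdet_id_eq_bdet {a b N : ℕ} (h : a + b = N) {I : Fin a → Fin N} {J : Fin b → Fin N}
    {T : Fin N → Fin N} (hI : ∀ s, T (blk h (Sum.inl s)) = I s)
    (hJ : ∀ s, T (blk h (Sum.inr s)) = J s) : kdet T id = bdet h I J := by
  unfold bdet
  rw [← kdet_comp_equiv (blk h) T id]
  congr 1
  ext (s | s)
  · exact congrArg Fin.val (hI s)
  · exact congrArg Fin.val (hJ s)

lemma kdet_concat_id {a b N : ℕ} (h : a + b = N) (I : Fin a → Fin N) (J : Fin b → Fin N) :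
    kdet (Sum.elim I J ∘ (blk h).symm) id = bdet h I J :=
  kdet_id_eq_bdet h (fun s => by simp) (fun s => by simp)

lemma sum_bdet_mul_bdet {a b N : ℕ} (h : a + b = N) (I L : Fin a → Fin N) :
    ∑ J, bdet h I J * bdet h L J = (b.factorial : ℝ) * kdet I L := by
  rw [← sum_kdet_sumElim b I L (by simpa using h)]
  refine Finset.sum_congr rfl fun J _ => ?_
  rw [← kdet_concat_id, ← kdet_concat_id, kdet_id_mul_kdet_id, kdet_comp_equiv]

lemma kdet_comp_finRotate_pow {N : ℕ} (hN : Even (N + 1)) (T L : Fin (N + 1) → Fin (N + 1))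
    (r : ℕ) : kdet (T ∘ ((finRotate (N + 1)) ^ r : Equiv.Perm _)) L = (-1) ^ r * kdet T L := by
  have : Odd N := by
    rcases N.even_or_odd with h | h
    · exact absurd hN (Nat.not_even_iff_odd.2 h.add_one)
    · exact h
  rw [kdet_comp_perm_left, map_pow, sign_finRotate, Nat.add_sub_cancel, this.neg_one_pow]
  simp

lemma finRotate_pow_val {N : ℕ} (r : ℕ) (t : Fin (N + 1)) :
    (((finRotate (N + 1)) ^ r : Equiv.Perm _) t : ℕ) = (t + r) % (N + 1) := by
  induction r with
  | zero => simp [Nat.mod_eq_of_lt t.isLt]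
  | succ r ih =>
    rw [pow_succ', Equiv.Perm.mul_apply, finRotate_apply, Fin.val_add, ih, Fin.coe_ofNat_eq_mod,
      ← Nat.add_mod, add_assoc]

lemma bdet_swap {a b N : ℕ} (h : a + b = N) (h' : b + a = N) (hN : Even N) (I : Fin a → Fin N)
    (J : Fin b → Fin N) : bdet h' J I = (-1) ^ a * bdet h I J := by
  cases N with
  | zero =>
    obtain rfl : a = 0 := by omega
    obtain rfl : b = 0 := by omega
    simp [bdet, kdet]
  | succ N =>
    rw [← kdet_concat_id h, ← kdet_comp_finRotate_pow hN]
    refine (kdet_id_eq_bdet h' (fun s => ?_) fun s => ?_).symm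
    · have : ((finRotate (N + 1)) ^ a : Equiv.Perm _) (blk h' (Sum.inl s)) = blk h (Sum.inr s) := by
        ext
        rw [finRotate_pow_val, blk_inl_val, blk_inr_val, Nat.mod_eq_of_lt (by omega), add_comm]
      simp [this]
    · have : ((finRotate (N + 1)) ^ a : Equiv.Perm _) (blk h' (Sum.inr s)) = blk h (Sum.inl s) := by
        ext
        rw [finRotate_pow_val, blk_inl_val, blk_inr_val, show b + (s : ℕ) + a = s + (N + 1) by omega,
          Nat.add_mod_right, Nat.mod_eq_of_lt (by omega)]
      simp [this]

lemma sum_bdet_mul_prod {a b N : ℕ} (h : a + b = N) (A : Matrix (Fin N) (Fin N) ℝ)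
    (I : Fin a → Fin N) (L : Fin b → Fin N) :
    ∑ J : Fin a → Fin N, ∑ K : Fin b → Fin N,
      bdet h J K * ((∏ t, A (I t) (J t)) * ∏ t, A (L t) (K t)) = A.det * bdet h I L := by
  rw [← kdet_concat_id, ← sum_kdet_mul_prod, ← Fintype.sum_prod_type']
  rw [← ((Equiv.sumArrowEquivProdArrow (Fin a) (Fin b) (Fin N)).symm.trans
    (Equiv.arrowCongr (blk h) (Equiv.refl _))).sum_comp]
  refine Finset.sum_congr rfl fun p _ => ?_
  have hp : ((Equiv.sumArrowEquivProdArrow (Fin a) (Fin b) (Fin N)).symm.trans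
    (Equiv.arrowCongr (blk h) (Equiv.refl _))) p = Sum.elim p.1 p.2 ∘ (blk h).symm := rfl
  rw [hp, kdet_concat_id, ← (blk h).prod_comp, Fintype.prod_sum_type]
  simp

lemma AltArr.insertNth {N r : ℕ} {F : (Fin (r + 1) → Fin N) → ℝ} (hF : AltArr F)
    (s : Fin (r + 1)) (a : Fin N) (I : Fin r → Fin N) :
    F (s.insertNth a I) = (-1) ^ (s : ℕ) * F (Fin.cons a I) := by
  have h := hF.1 (Fin.cons a I : Fin (r + 1) → Fin N) s.cycleRange
  rw [Fin.cons_comp_cycleRange, Fin.sign_cycleRange] at h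
  rw [h]
  simp

lemma sum_divergence {N r q : ℕ} (h : r + 1 + q = N) (h' : r + (q + 1) = N)
    {G : (Fin (r + 1) → Fin N) → Fin N → ℝ} (hG : ∀ a, AltArr fun I => G I a)
    (J : Fin (q + 1) → Fin N) :
    ∑ I : Fin (r + 1) → Fin N, ∑ i : Fin (q + 1),
        (-1 : ℝ) ^ (i : ℕ) * G I (J i) * bdet h I (fun j => J (i.succAbove j))
      = (-1) ^ r * (r + 1) *
        ∑ I : Fin r → Fin N, (∑ a, G (Fin.cons a I) a) * bdet h' I J := by
  have he : r + 1 + (q + 1) = N + 1 := by omega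
  have hT : ∀ I : Fin (r + 1) → Fin N,
      ∑ s : Fin (r + 1), (-1 : ℝ) ^ (s : ℕ) * G I (I s) * bdet h' (fun j => I (s.succAbove j)) J
      + (-1) ^ (r + 1) * ∑ i : Fin (q + 1),
        (-1 : ℝ) ^ (i : ℕ) * G I (J i) * bdet h I (fun j => J (i.succAbove j)) = 0 := by
    intro I
    set T : Fin (N + 1) → Fin N := Sum.elim I J ∘ (blk he).symm with hTdef
    have hT1 : ∀ z, T (blk he z) = Sum.elim I J z := fun z => by simp [hTdef]
    have h0 : ∑ t : Fin (N + 1), (-1 : ℝ) ^ (t : ℕ) * G I (T t)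
        * kdet (fun j => T (t.succAbove j)) id = 0 := by
      have h1 : ∑ a, G I a * ∑ t : Fin (N + 1), (-1 : ℝ) ^ (t : ℕ) * (if T t = a then 1 else 0)
          * kdet (fun j => T (t.succAbove j)) id = 0 :=
        Finset.sum_eq_zero fun a _ => by rw [sum_kdet_succAbove_eq_zero, mul_zero]
      rw [← h1]
      simp only [Finset.mul_sum]
      rw [Finset.sum_comm]
      refine Finset.sum_congr rfl fun t _ => ?_
      rw [Finset.sum_eq_single (T t)]
      · simp only [if_true]
        ring
      · intro b _ hb
        rw [if_neg hb.symm]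
        ring
      · simp
    rw [← (blk he).sum_comp, Fintype.sum_sum_type] at h0
    rw [← h0, Finset.mul_sum]
    congr 1
    · refine Finset.sum_congr rfl fun s _ => ?_
      rw [hT1, blk_inl_val, Sum.elim_inl]
      congr 1
      refine (kdet_id_eq_bdet h' (fun u => ?_) fun u => ?_).symm
      · have : (blk he (Sum.inl s)).succAbove (blk h' (Sum.inl u))
            = blk he (Sum.inl (s.succAbove u)) := by
          ext
          simp only [Fin.succAbove, Fin.lt_def, Fin.val_castSucc, blk_inl_val]
          split_ifs <;> simp [blk_inl_val]
        rw [this, hT1]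
        rfl
      · have : (blk he (Sum.inl s)).succAbove (blk h' (Sum.inr u)) = blk he (Sum.inr u) := by
          ext
          simp only [Fin.succAbove, Fin.lt_def, Fin.val_castSucc, blk_inl_val, blk_inr_val]
          rw [if_neg (by omega)]
          simp only [Fin.val_succ, blk_inr_val]
          omega
        rw [this, hT1]
        rfl
    · refine Finset.sum_congr rfl fun s _ => ?_
      rw [hT1, blk_inr_val, Sum.elim_inr, pow_add _ (r + 1), mul_assoc, mul_assoc, mul_assoc]
      congr 3
      refine (kdet_id_eq_bdet h (fun u => ?_) fun u => ?_).symm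
      · have : (blk he (Sum.inr s)).succAbove (blk h (Sum.inl u)) = blk he (Sum.inl u) := by
          ext
          simp only [Fin.succAbove, Fin.lt_def, Fin.val_castSucc, blk_inl_val, blk_inr_val]
          rw [if_pos (by omega)]
          simp only [Fin.val_castSucc, blk_inl_val]
        rw [this, hT1]
        rfl
      · have : (blk he (Sum.inr s)).succAbove (blk h (Sum.inr u))
            = blk he (Sum.inr (s.succAbove u)) := by
          ext
          simp only [Fin.succAbove, Fin.lt_def, Fin.val_castSucc, blk_inr_val,
            Nat.add_lt_add_iff_left]
          split_ifs <;> simp [blk_inr_val, add_assoc]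
        rw [this, hT1]
        rfl
  have hs : ∀ s : Fin (r + 1), ∑ I : Fin (r + 1) → Fin N,
      (-1 : ℝ) ^ (s : ℕ) * G I (I s) * bdet h' (fun j => I (s.succAbove j)) J
      = ∑ I : Fin r → Fin N, (∑ a, G (Fin.cons a I) a) * bdet h' I J := by
    intro s
    rw [← (Fin.insertNthEquiv (fun _ => Fin N) s).sum_comp, Fintype.sum_prod_type_right]
    refine Finset.sum_congr rfl fun I _ => ?_
    rw [Finset.sum_mul]
    refine Finset.sum_congr rfl fun a _ => ?_
    simp only [Fin.insertNthEquiv_apply, Fin.insertNth_apply_same, Fin.insertNth_apply_succAbove]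
    have hi : G (Fin.insertNthEquiv (fun _ => Fin N) s (a, I)) a
        = (-1) ^ (s : ℕ) * G (Fin.cons a I) a := (hG a).insertNth s a I
    rw [hi, ← mul_assoc, ← mul_pow]
    simp
  have hsum : ∑ I : Fin (r + 1) → Fin N,
      (∑ s : Fin (r + 1), (-1 : ℝ) ^ (s : ℕ) * G I (I s) *
          bdet h' (fun j => I (s.succAbove j)) J
      + (-1) ^ (r + 1) * ∑ i : Fin (q + 1),
        (-1 : ℝ) ^ (i : ℕ) * G I (J i) * bdet h I (fun j => J (i.succAbove j))) = 0 :=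
    Finset.sum_eq_zero fun I _ => hT I
  rw [Finset.sum_add_distrib, Finset.sum_comm, ← Finset.mul_sum] at hsum
  simp only [hs, Finset.sum_const, Finset.card_univ, Fintype.card_fin, nsmul_eq_mul] at hsum
  have hr : (-1 : ℝ) ^ r * (-1) ^ r = 1 := by
    rw [← mul_pow]
    simp
  push_cast at hsum
  rw [pow_succ] at hsum
  linear_combination -(-1 : ℝ) ^ r * hsum - (∑ I : Fin (r + 1) → Fin N, ∑ i : Fin (q + 1),
        (-1 : ℝ) ^ (i : ℕ) * G I (J i) * bdet h I (fun j => J (i.succAbove j))) * hr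

lemma contDiffOn_wedgeF {N p q : ℕ} {ω : Form N p} {η : Form N q} {M : Set (Pt N)}
    (hω : ∀ I, ContDiffOn ℝ (⊤ : ℕ∞) (fun x => ω x I) M)
    (hη : ∀ I, ContDiffOn ℝ (⊤ : ℕ∞) (fun x => η x I) M) (I : Fin (p + q) → Fin N) :
    ContDiffOn ℝ (⊤ : ℕ∞) (fun x => wedgeF p q ω η x I) M := by
  unfold wedgeF
  exact contDiffOn_const.mul (ContDiffOn.sum fun τ _ => (contDiffOn_const.mul (hω _)).mul (hη _))

lemma contDiffOn_wpow {N : ℕ} {ω : Form N 2} {M : Set (Pt N)}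
    (hω : ∀ I, ContDiffOn ℝ (⊤ : ℕ∞) (fun x => ω x I) M) (m : ℕ) :
    ∀ I, ContDiffOn ℝ (⊤ : ℕ∞) (fun x => wpow ω m x I) M := by
  induction m with
  | zero => exact fun I => contDiffOn_const
  | succ m ih => exact fun I => contDiffOn_wedgeF ih hω I

lemma contDiffOn_volF {N : ℕ} {ω : Form N 2} {M : Set (Pt N)}
    (hω : ∀ I, ContDiffOn ℝ (⊤ : ℕ∞) (fun x => ω x I) M) (m : ℕ) (I : Fin (2 * m) → Fin N) :
    ContDiffOn ℝ (⊤ : ℕ∞) (fun x => volF m ω x I) M :=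
  contDiffOn_const.mul (contDiffOn_wpow hω m I)

lemma contDiffOn_sharpF {N p : ℕ} {Λ : Form N 2} {ζ : Form N p} {M : Set (Pt N)}
    (hΛ : ∀ I, ContDiffOn ℝ (⊤ : ℕ∞) (fun x => Λ x I) M)
    (hζ : ∀ I, ContDiffOn ℝ (⊤ : ℕ∞) (fun x => ζ x I) M) (J : Fin p → Fin N) :
    ContDiffOn ℝ (⊤ : ℕ∞) (fun x => sharpF Λ p ζ x J) M := by
  unfold sharpF
  exact contDiffOn_const.mul (ContDiffOn.sum fun I _ =>
    (hζ I).mul (contDiffOn_prod fun t _ => hΛ _))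

lemma altArr_sharpF {N p : ℕ} (Λ : Form N 2) {ζ : Form N p} {x : Pt N} (hζ : AltArr (ζ x)) :
    AltArr (sharpF Λ p ζ x) := by
  refine altArr_of_perm fun J τ => ?_
  unfold sharpF
  rw [mul_left_comm]
  congr 1
  rw [Finset.mul_sum, ← (Equiv.arrowCongr τ.symm (Equiv.refl (Fin N))).sum_comp
    fun I => ζ x I * ∏ t, Λ x ![I t, (J ∘ τ) t]]
  refine Finset.sum_congr rfl fun I _ => ?_
  have hI : Equiv.arrowCongr τ.symm (Equiv.refl (Fin N)) I = I ∘ τ := rfl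
  rw [hI, hζ.1, ← Equiv.prod_comp τ fun t => Λ x ![I t, J t], mul_assoc]
  rfl

lemma IsFormOn.sharpF {N p : ℕ} {Λ : Form N 2} {ζ : Form N p} {M : Set (Pt N)}
    (hζ : IsFormOn ζ M) (hΛ : IsFormOn Λ M) : IsFormOn (sharpF Λ p ζ) M :=
  ⟨fun x hx => altArr_sharpF Λ (hζ.1 x hx), contDiffOn_sharpF hΛ.2 hζ.2⟩

lemma AltArr.pd {N p : ℕ} {P : Form N p} {M : Set (Pt N)} (hM : IsOpen M)
    (hP : ∀ y ∈ M, AltArr (P y)) {x : Pt N} (hx : x ∈ M) (a : Fin N) :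
    AltArr fun I => pd (fun y => P y I) a x := by
  refine altArr_of_perm fun I τ => ?_
  have : (fun y => P y (I ∘ τ))
      =ᶠ[nhds x] fun y => (((Equiv.Perm.sign τ : ℤ) : ℝ)) * P y I := by
    filter_upwards [hM.mem_nhds hx] with y hy using (hP y hy).1 I τ
  unfold Damianou.pd
  rw [this.fderiv_eq]
  rcases Int.units_eq_one_or (Equiv.Perm.sign τ) with h | h <;>
    simp [h, fderiv_fun_neg]

lemma bdet_cast {a b b' N : ℕ} (e : b = b') (h : a + b = N) (h' : a + b' = N) (I : Fin a → Fin N)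
    (J : Fin b' → Fin N) : bdet h I (fun t => J (Fin.cast e t)) = bdet h' I J := by
  subst e
  rfl

lemma adjF_eq {n p : ℕ} (h : p + (2 * n - p) = 2 * n) (ω₀ Λ₀ : Form (2 * n) 2)
    (φ : Form (2 * n) p) (y : Pt (2 * n)) (J : Fin (2 * n - p) → Fin (2 * n)) :
    adjF ω₀ Λ₀ p φ y J = (p.factorial : ℝ)⁻¹ *
      ∑ I, volF n ω₀ y id * sharpF Λ₀ p φ y I * bdet h I J := by
  have hs : (-1 : ℝ) ^ (p * (p - 1) / 2) * (-1) ^ (p * (p - 1) / 2) = 1 := by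
    rw [← mul_pow]
    simp
  unfold adjF smulF iF
  rw [← mul_assoc, ← mul_assoc, hs, one_mul]
  congr 1
  refine Finset.sum_congr rfl fun I _ => ?_
  rw [(altArr_volF n ω₀ y).eq_kdet_mul, kdet_id_eq_bdet h (I := I) (J := J)]
  · ring
  · intro s
    simp [catIdx, blk_inl_val]
  · intro s
    simp [catIdx, blk_inr_val]

lemma extd_adjF {n r : ℕ} (h' : r + (2 * n - (r + 1) + 1) = 2 * n) {ω₀ Λ₀ : Form (2 * n) 2}
    {φ : Form (2 * n) (r + 1)} {M : Set (Pt (2 * n))} (hM : IsOpen M) (hω : IsFormOn ω₀ M)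
    (hΛ : IsFormOn Λ₀ M) (hφ : IsFormOn φ M) {x : Pt (2 * n)} (hx : x ∈ M)
    (J : Fin (2 * n - (r + 1) + 1) → Fin (2 * n)) :
    extd (adjF ω₀ Λ₀ (r + 1) φ) x J = (-1) ^ r * (r.factorial : ℝ)⁻¹ *
      ∑ I : Fin r → Fin (2 * n),
        (∑ a, pd (fun y => volF n ω₀ y id * sharpF Λ₀ (r + 1) φ y (Fin.cons a I)) a x)
          * bdet h' I J := by
  have h : r + 1 + (2 * n - (r + 1)) = 2 * n := by omega
  have hd : ∀ I, DifferentiableAt ℝ (fun y => volF n ω₀ y id * sharpF Λ₀ (r + 1) φ y I) x :=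
    fun I => (((contDiffOn_volF hω.2 n id).mul ((hφ.sharpF hΛ).2 I)).contDiffAt
      (hM.mem_nhds hx)).differentiableAt (by simp)
  have hG : ∀ a, AltArr fun I =>
      pd (fun y => volF n ω₀ y id * sharpF Λ₀ (r + 1) φ y I) a x := fun a =>
    AltArr.pd (P := fun y I => volF n ω₀ y id * sharpF Λ₀ (r + 1) φ y I) hM
      (fun y hy => ((hφ.sharpF hΛ).1 y hy).const_mul _) hx a
  have key := sum_divergence h h' hG J
  have hpd : ∀ (i : Fin (2 * n - (r + 1) + 1)),
      fderiv ℝ (fun y => adjF ω₀ Λ₀ (r + 1) φ y fun j => J (i.succAbove j)) x (Pi.single (J i) 1)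
      = ((r + 1).factorial : ℝ)⁻¹ * ∑ I,
        pd (fun y => volF n ω₀ y id * sharpF Λ₀ (r + 1) φ y I) (J i) x
          * bdet h I (fun j => J (i.succAbove j)) := by
    intro i
    simp only [adjF_eq h]
    rw [fderiv_const_mul (DifferentiableAt.fun_sum fun I _ => (hd I).mul_const _),
      fderiv_fun_sum fun I _ => (hd I).mul_const _]
    simp only [fderiv_mul_const (hd _), smul_apply, _root_.sum_apply, smul_eq_mul, pd]
    congr 1
    exact Finset.sum_congr rfl fun I _ => mul_comm _ _
  unfold extd
  simp only [hpd]
  have hfac : ((r + 1).factorial : ℝ)⁻¹ * ((r : ℝ) + 1) = (r.factorial : ℝ)⁻¹ := by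
    rw [Nat.factorial_succ]
    push_cast
    field_simp
  rw [← hfac, mul_comm (((r + 1).factorial : ℝ)⁻¹), ← mul_assoc, mul_right_comm, ← key,
    Finset.sum_comm, Finset.sum_mul]
  refine Finset.sum_congr rfl fun i _ => ?_
  rw [mul_left_comm, Finset.mul_sum, mul_comm]
  congr 1
  exact Finset.sum_congr rfl fun I _ => by ring

lemma AltArr.divergence {N r : ℕ} {G : (Fin (r + 1) → Fin N) → Fin N → ℝ}
    (hG : ∀ a, AltArr fun I => G I a) : AltArr fun I : Fin r → Fin N => ∑ a, G (Fin.cons a I) a := by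
  refine altArr_of_perm fun I τ => ?_
  rw [Finset.mul_sum]
  refine Finset.sum_congr rfl fun a _ => ?_
  have h := (hG a).1 (Fin.cons a I) (Equiv.Perm.decomposeFin.symm (0, τ))
  rw [Equiv.Perm.decomposeFin.symm_sign, if_pos rfl, one_mul] at h
  rw [← h]
  congr 1
  funext t
  refine Fin.cases ?_ (fun s => ?_) t
  · simp
  · simp

lemma sharpF_codiffF {n r : ℕ} (hr : r + 1 ≤ 2 * n) {ω₀ Λ₀ : Form (2 * n) 2}
    {φ : Form (2 * n) (r + 1)} {M : Set (Pt (2 * n))} (hM : IsOpen M) (hω : IsFormOn ω₀ M)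
    (hΛ : IsFormOn Λ₀ M) (hφ : IsFormOn φ M) {x : Pt (2 * n)} (hx : x ∈ M)
    (L : Fin r → Fin (2 * n)) :
    sharpF Λ₀ r (codiffF ω₀ Λ₀ (r + 1) φ) x L = (-1) ^ r * volF n ω₀ x id * (mat2 Λ₀ x).det *
      ∑ a, pd (fun y => volF n ω₀ y id * sharpF Λ₀ (r + 1) φ y (Fin.cons a L)) a x := by
  set q := 2 * n - (r + 1) with hq
  have h' : r + (q + 1) = 2 * n := by omega
  have h3 : q + 1 + r = 2 * n := by omega
  have h4 : q + 1 + (2 * n - (q + 1)) = 2 * n := by omega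
  have e : 2 * n - (q + 1) = r := by omega
  set ψ := extd (adjF ω₀ Λ₀ (r + 1) φ) with hψ
  set Q : (Fin r → Fin (2 * n)) → ℝ := fun I =>
    ∑ a, pd (fun y => volF n ω₀ y id * sharpF Λ₀ (r + 1) φ y (Fin.cons a I)) a x with hQdef
  have hQ : AltArr Q := AltArr.divergence fun a =>
    AltArr.pd (P := fun y I => volF n ω₀ y id * sharpF Λ₀ (r + 1) φ y I) hM
      (fun y hy => ((hφ.sharpF hΛ).1 y hy).const_mul _) hx a
  have hc : ∀ L', codiffF ω₀ Λ₀ (r + 1) φ x L' = ((q + 1).factorial : ℝ)⁻¹ *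
      ∑ K, volF n ω₀ x id * sharpF Λ₀ (q + 1) ψ x K * bdet h3 K L' := by
    intro L'
    have hcc : codiffF ω₀ Λ₀ (r + 1) φ = castF e (adjF ω₀ Λ₀ (q + 1) ψ) := dif_pos e
    rw [hcc]
    unfold castF
    rw [adjF_eq h4]
    congr 1
    exact Finset.sum_congr rfl fun K _ => by rw [bdet_cast e h4 h3]
  have hflip : ∀ L' : Fin r → Fin (2 * n),
      ∏ t, Λ₀ x ![L' t, L t] = (-1) ^ r * ∏ t, mat2 Λ₀ x (L t) (L' t) := by
    intro L'
    have : ∀ t, Λ₀ x ![L' t, L t] = -1 * mat2 Λ₀ x (L t) (L' t) := fun t => by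
      rw [(hΛ.1 x hx).swap]
      simp [mat2]
    simp only [this, Finset.prod_mul_distrib, Finset.prod_const, Finset.card_univ, Fintype.card_fin]
  have hsr : ((-1 : ℝ) ^ r) * (-1) ^ r = 1 := by
    rw [← mul_pow]
    simp
  have hsq : ((-1 : ℝ) ^ (q + 1)) = (-1) ^ r := by
    have : ((-1 : ℝ) ^ (q + 1)) * (-1) ^ r = 1 := by
      rw [← pow_add, h3, pow_mul]
      simp
    linear_combination (-1 : ℝ) ^ r * this - (-1 : ℝ) ^ (q + 1) * hsr
  have h1 : sharpF Λ₀ r (codiffF ω₀ Λ₀ (r + 1) φ) x L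
      = (-1) ^ r * ((q + 1).factorial : ℝ)⁻¹ * volF n ω₀ x id * (mat2 Λ₀ x).det *
        ∑ J, ψ x J * bdet h3 J L := by
    have h2 : ∀ J : Fin (q + 1) → Fin (2 * n), (mat2 Λ₀ x).det * bdet h3 J L = 
      ∑ K : Fin (q + 1) → Fin (2 * n), ∑ L' : Fin r → Fin (2 * n),
      bdet h3 K L' * ((∏ t, mat2 Λ₀ x (J t) (K t)) * ∏ t, mat2 Λ₀ x (L t) (L' t)) := fun J =>
      (sum_bdet_mul_prod h3 _ _ _).symm
    have h5 : (-1 : ℝ) ^ r * ((q + 1).factorial : ℝ)⁻¹ * volF n ω₀ x id * (mat2 Λ₀ x).det *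
        ∑ J, ψ x J * bdet h3 J L = ∑ J : Fin (q + 1) → Fin (2 * n),
        ∑ K : Fin (q + 1) → Fin (2 * n), ∑ L' : Fin r → Fin (2 * n),
        (-1 : ℝ) ^ r * ((q + 1).factorial : ℝ)⁻¹ * volF n ω₀ x id * ψ x J * (bdet h3 K L' *
          ((∏ t, mat2 Λ₀ x (J t) (K t)) * ∏ t, mat2 Λ₀ x (L t) (L' t))) := by
      rw [Finset.mul_sum]
      refine Finset.sum_congr rfl fun J _ => ?_
      simp only [← Finset.mul_sum]
      rw [← h2]
      ring
    rw [h5]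
    conv_lhs => unfold sharpF
    simp only [hc, hflip]
    unfold sharpF
    simp only [Finset.mul_sum, Finset.sum_mul]
    rw [Finset.sum_comm, Finset.sum_congr rfl fun K _ => Finset.sum_comm, Finset.sum_comm]
    refine Finset.sum_congr rfl fun J _ => Finset.sum_congr rfl fun K _ =>
      Finset.sum_congr rfl fun L' _ => ?_
    have : ∀ t, Λ₀ x ![J t, K t] = mat2 Λ₀ x (J t) (K t) := fun t => rfl
    simp only [this]
    rw [hsq]
    linear_combination ((-1 : ℝ) ^ r * ((q + 1).factorial : ℝ)⁻¹ * volF n ω₀ x id * ψ x J *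
      (bdet h3 K L' * ((∏ t, mat2 Λ₀ x (J t) (K t)) * ∏ t, mat2 Λ₀ x (L t) (L' t)))) * hsr
  have h2 : ∑ J, ψ x J * bdet h3 J L = ((q + 1).factorial : ℝ) * Q L := by
    have hψJ : ∀ J, ψ x J * bdet h3 J L = ∑ I, (r.factorial : ℝ)⁻¹ * Q I *
        (bdet h' I J * bdet h' L J) := by
      intro J
      rw [hψ, extd_adjF h' hM hω hΛ hφ hx, bdet_swap h' h3 ⟨n, two_mul n⟩ L J, Finset.mul_sum,
        Finset.sum_mul]
      refine Finset.sum_congr rfl fun I _ => ?_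
      linear_combination ((r.factorial : ℝ)⁻¹ * Q I * (bdet h' I J * bdet h' L J)) * hsr
    simp only [hψJ]
    rw [Finset.sum_comm]
    have : ∀ I, ∑ J, (r.factorial : ℝ)⁻¹ * Q I * (bdet h' I J * bdet h' L J)
        = (r.factorial : ℝ)⁻¹ * ((q + 1).factorial : ℝ) * (Q I * kdet I L) := fun I => by
      rw [← Finset.mul_sum, sum_bdet_mul_bdet]
      ring
    rw [Finset.sum_congr rfl fun I _ => this I, ← Finset.mul_sum, sum_mul_kdet hQ]
    field_simp
  rw [h1, h2, hQdef]
  field_simp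

lemma sum_append_mul_prod {N p q : ℕ} (A : Fin N → Fin N → ℝ) (u : (Fin p → Fin N) → ℝ)
    (v : (Fin q → Fin N) → ℝ) (J : Fin (p + q) → Fin N) :
    ∑ I : Fin (p + q) → Fin N, u (fun i => I (Fin.castAdd q i)) * v (fun j => I (Fin.natAdd p j)) *
        ∏ t, A (I t) (J t)
      = (∑ I, u I * ∏ t, A (I t) (J (Fin.castAdd q t))) *
        ∑ I, v I * ∏ t, A (I t) (J (Fin.natAdd p t)) := by
  rw [← (Fin.appendEquiv p q).sum_comp, Fintype.sum_prod_type, Finset.sum_mul_sum]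
  refine Finset.sum_congr rfl fun I _ => Finset.sum_congr rfl fun K _ => ?_
  simp only [Fin.appendEquiv, Equiv.coe_fn_mk, Fin.append_left, Fin.append_right,
    Fin.prod_univ_add]
  ring

lemma sharpF_wedgeF {N p q : ℕ} (Λ : Form N 2) (α : Form N p) (β : Form N q) (x : Pt N)
    (J : Fin (p + q) → Fin N) :
    sharpF Λ (p + q) (wedgeF p q α β) x J
      = wedgeF p q (sharpF Λ p α) (sharpF Λ q β) x J := by
  unfold sharpF wedgeF
  have h : ∀ τ : Equiv.Perm (Fin (p + q)),
      ∑ I : Fin (p + q) → Fin N, α x (fun i => I (τ (Fin.castAdd q i))) *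
        β x (fun j => I (τ (Fin.natAdd p j))) * ∏ t, Λ x ![I t, J t]
      = (∑ I, α x I * ∏ t, Λ x ![I t, J (τ (Fin.castAdd q t))]) *
        ∑ I, β x I * ∏ t, Λ x ![I t, J (τ (Fin.natAdd p t))] := by
    intro τ
    rw [← sum_append_mul_prod (fun i j => Λ x ![i, j]) (α x) (β x) fun t => J (τ t)]
    rw [← (Equiv.arrowCongr τ (Equiv.refl (Fin N))).sum_comp]
    refine Finset.sum_congr rfl fun I _ => ?_
    have hI : Equiv.arrowCongr τ (Equiv.refl (Fin N)) I = I ∘ τ.symm := rfl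
    rw [hI, ← Equiv.prod_comp τ]
    simp
  simp only [Finset.mul_sum, Finset.sum_mul]
  rw [Finset.sum_comm]
  refine Finset.sum_congr rfl fun τ _ => ?_
  have h2 := congrArg (fun z : ℝ => (-1) ^ (p + q) * (((p.factorial : ℝ) * q.factorial)⁻¹ *
    ((Equiv.Perm.sign τ : ℤ) : ℝ)) * z) (h τ)
  simp only [Finset.mul_sum, Finset.sum_mul] at h2
  refine Eq.trans (Finset.sum_congr rfl fun I _ => ?_) (h2.trans
    (Finset.sum_congr rfl fun I _ => Finset.sum_congr rfl fun K _ => ?_))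
  · ring
  · rw [pow_add]
    ring

lemma sum_perm_three (F : Fin 3 → Fin 3 → Fin 3 → ℝ) :
    ∑ τ : Equiv.Perm (Fin 3), ((Equiv.Perm.sign τ : ℤ) : ℝ) * F (τ 0) (τ 1) (τ 2)
      = F 0 1 2 - F 0 2 1 - F 1 0 2 + F 1 2 0 + F 2 0 1 - F 2 1 0 := by
  have h : (univ : Finset (Equiv.Perm (Fin 3))) = {1, Equiv.swap 1 2, Equiv.swap 0 1,
      Equiv.swap 0 1 * Equiv.swap 1 2, Equiv.swap 1 2 * Equiv.swap 0 1, Equiv.swap 0 2} := by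
    decide
  rw [h]
  repeat rw [Finset.sum_insert (by decide)]
  rw [Finset.sum_singleton]
  simp [Equiv.swap_apply_def, Equiv.Perm.sign_swap']
  ring

lemma sum_perm_succ {n : ℕ} (F : Equiv.Perm (Fin (n + 1)) → ℝ) :
    ∑ τ, ((Equiv.Perm.sign τ : ℤ) : ℝ) * F τ
      = ∑ p : Fin (n + 1), ∑ τ : Equiv.Perm (Fin n), (if p = 0 then 1 else -1) *
        (((Equiv.Perm.sign τ : ℤ) : ℝ) * F (Equiv.Perm.decomposeFin.symm (p, τ))) := by
  rw [← (Equiv.Perm.decomposeFin (n := n)).symm.sum_comp, Fintype.sum_prod_type]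
  refine Finset.sum_congr rfl fun p _ => Finset.sum_congr rfl fun τ _ => ?_
  rw [Equiv.Perm.decomposeFin.symm_sign]
  split_ifs <;> simp

lemma sum_perm_four (F : Fin 4 → Fin 4 → Fin 4 → Fin 4 → ℝ) :
    ∑ τ : Equiv.Perm (Fin 4), ((Equiv.Perm.sign τ : ℤ) : ℝ) * F (τ 0) (τ 1) (τ 2) (τ 3)
      = F 0 1 2 3 - F 0 1 3 2 - F 0 2 1 3 + F 0 2 3 1 + F 0 3 1 2 - F 0 3 2 1
        + F 1 0 3 2 - F 1 0 2 3 + F 1 2 0 3 - F 1 2 3 0 - F 1 3 0 2 + F 1 3 2 0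
        + F 2 0 1 3 - F 2 0 3 1 - F 2 1 0 3 + F 2 1 3 0 + F 2 3 0 1 - F 2 3 1 0
        + F 3 0 2 1 - F 3 0 1 2 + F 3 1 0 2 - F 3 1 2 0 - F 3 2 0 1 + F 3 2 1 0 := by
  rw [sum_perm_succ fun τ => F (τ 0) (τ 1) (τ 2) (τ 3)]
  have h : ∀ (p : Fin 4) (τ : Equiv.Perm (Fin 3)) (t : Fin 3),
      Equiv.Perm.decomposeFin.symm (p, τ) t.succ = Equiv.swap 0 p (τ t).succ :=
    fun p τ t => Equiv.Perm.decomposeFin_symm_apply_succ τ p t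
  have h1 := fun p τ => h p τ 0
  have h2 := fun p τ => h p τ 1
  have h3 := fun p τ => h p τ 2
  simp only [Fin.reduceSucc] at h1 h2 h3
  simp only [h1, h2, h3, Equiv.Perm.decomposeFin_symm_apply_zero, ← Finset.mul_sum]
  have h4 := fun p => sum_perm_three fun a b c =>
    F p (Equiv.swap 0 p a.succ) (Equiv.swap 0 p b.succ) (Equiv.swap 0 p c.succ)
  simp only [h4]
  simp [Fin.sum_univ_four, Equiv.swap_apply_def]
  ring

lemma wedgeF_two_one {N : ℕ} {α : Form N 2} {β : Form N 1} {x : Pt N} (hα : AltArr (α x))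
    (j k l : Fin N) : wedgeF 2 1 α β x ![j, k, l]
      = α x ![j, k] * β x ![l] - α x ![j, l] * β x ![k] + α x ![k, l] * β x ![j] := by
  have h2 : ∀ (I : Fin 3 → Fin N) (τ : Equiv.Perm (Fin 3)),
      (fun i : Fin 2 => I (τ (Fin.castAdd 1 i))) = ![I (τ 0), I (τ 1)] := fun I τ => by
    ext i
    fin_cases i <;> rfl
  have h1 : ∀ (I : Fin 3 → Fin N) (τ : Equiv.Perm (Fin 3)),
      (fun i : Fin 1 => I (τ (Fin.natAdd 2 i))) = ![I (τ 2)] := fun I τ => by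
    ext i
    fin_cases i
    rfl
  unfold wedgeF
  simp only [h1, h2, mul_assoc]
  rw [sum_perm_three fun a b c => α x ![![j, k, l] a, ![j, k, l] b] * β x ![![j, k, l] c]]
  simp only [Matrix.cons_val]
  rw [hα.swap j k, hα.swap j l, hα.swap k l]
  norm_num [Nat.factorial]
  ring

lemma wedgeF_two_two_self {N : ℕ} {α : Form N 2} {x : Pt N} (hα : AltArr (α x))
    (i j k l : Fin N) : wedgeF 2 2 α α x ![i, j, k, l]
      = 2 * (α x ![i, j] * α x ![k, l] - α x ![i, k] * α x ![j, l]
        + α x ![i, l] * α x ![j, k]) := by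
  have h1 : ∀ (I : Fin 4 → Fin N) (τ : Equiv.Perm (Fin 4)),
      (fun i : Fin 2 => I (τ (Fin.castAdd 2 i))) = ![I (τ 0), I (τ 1)] := fun I τ => by
    ext i
    fin_cases i <;> rfl
  have h2 : ∀ (I : Fin 4 → Fin N) (τ : Equiv.Perm (Fin 4)),
      (fun i : Fin 2 => I (τ (Fin.natAdd 2 i))) = ![I (τ 2), I (τ 3)] := fun I τ => by
    ext i
    fin_cases i <;> rfl
  unfold wedgeF
  simp only [h1, h2, mul_assoc]
  rw [sum_perm_four fun a b c d => α x ![![i, j, k, l] a, ![i, j, k, l] b] *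
    α x ![![i, j, k, l] c, ![i, j, k, l] d]]
  simp only [Matrix.cons_val]
  rw [hα.swap i j, hα.swap i k, hα.swap i l, hα.swap j k, hα.swap j l, hα.swap k l]
  norm_num [Nat.factorial]
  ring

lemma pd_mul {N : ℕ} {f g : Pt N → ℝ} {x : Pt N} (hf : DifferentiableAt ℝ f x)
    (hg : DifferentiableAt ℝ g x) (a : Fin N) :
    pd (fun y => f y * g y) a x = pd f a x * g x + f x * pd g a x := by
  unfold pd
  rw [fderiv_fun_mul hf hg]
  simp
  ring

lemma pd_sum {N : ℕ} {ι : Type*} {s : Finset ι} {f : ι → Pt N → ℝ} {x : Pt N}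
    (hf : ∀ i ∈ s, DifferentiableAt ℝ (f i) x) (a : Fin N) :
    pd (fun y => ∑ i ∈ s, f i y) a x = ∑ i ∈ s, pd (f i) a x := by
  unfold pd
  rw [fderiv_fun_sum hf, _root_.sum_apply]

lemma sharpF_congr_apply {N p : ℕ} (Λ : Form N 2) {α β : Form N p} {x : Pt N}
    (h : ∀ I, α x I = β x I) (J : Fin p → Fin N) : sharpF Λ p α x J = sharpF Λ p β x J := by
  unfold sharpF
  simp only [h]

lemma AlmostSymp.volF_id_ne_zero {n : ℕ} {ω₀ Λ₀ : Form (2 * n) 2} {M : Set (Pt (2 * n))}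
    (h : AlmostSymp ω₀ Λ₀ M) {x : Pt (2 * n)} (hx : x ∈ M) : volF n ω₀ x id ≠ 0 := by
  intro h0
  have h1 : volF n ω₀ x = fun I => 0 * volF n ω₀ x I := by
    funext I
    rw [(altArr_volF n ω₀ x).eq_kdet_mul, h0, mul_zero, zero_mul]
  refine ne_zero_of_divPow (h.sympPair hx) ?_
  rw [← toEA_volF, h1, toEA_smul, zero_smul]

/-- The compatibility condition on `σ` says that `Λ₀^#(σ)` commutes with itself for the
Schouten bracket. -/
lemma DeltaCond.schouten {n : ℕ} (hn : 2 ≤ n) {ω₀ Λ₀ σ : Form (2 * n) 2} {M : Set (Pt (2 * n))}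
    (hM : IsOpen M) (hsymp : AlmostSymp ω₀ Λ₀ M) (hσ : IsFormOn σ M) (hδ : DeltaCond ω₀ Λ₀ σ M)
    {x : Pt (2 * n)} (hx : x ∈ M) (j k l : Fin (2 * n)) :
    ∑ a, (sharpF Λ₀ 2 σ x ![a, j] * pd (fun y => sharpF Λ₀ 2 σ y ![k, l]) a x
      + sharpF Λ₀ 2 σ x ![a, k] * pd (fun y => sharpF Λ₀ 2 σ y ![l, j]) a x
      + sharpF Λ₀ 2 σ x ![a, l] * pd (fun y => sharpF Λ₀ 2 σ y ![j, k]) a x) = 0 := by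
  obtain ⟨hω, hΛ₀, hinv⟩ := hsymp
  set Λ := sharpF Λ₀ 2 σ with hΛdef
  have hΛ : IsFormOn Λ M := hσ.sharpF hΛ₀
  set μ : Pt (2 * n) → ℝ := fun y => volF n ω₀ y id with hμ
  have hμ0 : μ x ≠ 0 := AlmostSymp.volF_id_ne_zero ⟨hω, hΛ₀, hinv⟩ hx
  have hdet : (mat2 Λ₀ x).det ≠ 0 := by
    intro h0
    have := congrArg Matrix.det (hinv x hx)
    rw [Matrix.det_mul, h0, mul_zero, Matrix.det_neg, Matrix.det_one, mul_one] at this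
    exact pow_ne_zero _ (by norm_num) this.symm
  have hσσ : IsFormOn (wedgeF 2 2 σ σ) M :=
    ⟨fun y _ => altArr_wedgeF σ σ y, contDiffOn_wedgeF hσ.2 hσ.2⟩
  have hdΛ : ∀ I, DifferentiableAt ℝ (fun y => Λ y I) x := fun I =>
    ((hΛ.2 I).contDiffAt (hM.mem_nhds hx)).differentiableAt (by simp)
  have hdμ : DifferentiableAt ℝ μ x :=
    ((contDiffOn_volF hω.2 n id).contDiffAt (hM.mem_nhds hx)).differentiableAt (by simp)
  set V : Fin (2 * n) → ℝ := fun l => ∑ a, pd (fun y => μ y * Λ y ![a, l]) a x with hV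
  have hv : ∀ l, sharpF Λ₀ 1 (codiffF ω₀ Λ₀ 2 σ) x ![l] = -(μ x * (mat2 Λ₀ x).det) * V l := by
    intro l
    have := sharpF_codiffF (r := 1) (by omega) hM hω hΛ₀ hσ hx ![l]
    rw [this, pow_one, neg_one_mul, ← neg_mul]
    rfl
  have h4 : sharpF Λ₀ 3 (codiffF ω₀ Λ₀ 4 (wedgeF 2 2 σ σ)) x ![j, k, l]
      = -(μ x * (mat2 Λ₀ x).det) *
        ∑ a, pd (fun y => μ y * sharpF Λ₀ 4 (wedgeF 2 2 σ σ) y ![a, j, k, l]) a x := by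
    have := sharpF_codiffF (r := 3) (by omega) hM hω hΛ₀ hσσ hx ![j, k, l]
    rw [this, Odd.neg_one_pow (by decide), neg_one_mul, ← neg_mul]
    rfl
  have hpd : ∀ a, pd (fun y => μ y * sharpF Λ₀ 4 (wedgeF 2 2 σ σ) y ![a, j, k, l]) a x
      = 2 * (pd (fun y => μ y * Λ y ![a, j]) a x * Λ x ![k, l]
          - pd (fun y => μ y * Λ y ![a, k]) a x * Λ x ![j, l]
          + pd (fun y => μ y * Λ y ![a, l]) a x * Λ x ![j, k]
          + μ x * (Λ x ![a, j] * pd (fun y => Λ y ![k, l]) a x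
            + Λ x ![a, k] * pd (fun y => Λ y ![l, j]) a x
            + Λ x ![a, l] * pd (fun y => Λ y ![j, k]) a x)) := by
    intro a
    have he : (fun y => μ y * sharpF Λ₀ 4 (wedgeF 2 2 σ σ) y ![a, j, k, l]) =ᶠ[nhds x]
        fun y => 2 * (((μ y * Λ y ![a, j]) * Λ y ![k, l] + (μ y * Λ y ![a, k]) * Λ y ![l, j])
          + (μ y * Λ y ![a, l]) * Λ y ![j, k]) := by
      filter_upwards [hM.mem_nhds hx] with y hy
      rw [sharpF_wedgeF (p := 2) (q := 2), wedgeF_two_two_self (hΛ.1 y hy), (hΛ.1 y hy).swap j l]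
      ring
    have hm : ∀ I J, DifferentiableAt ℝ (fun y => (μ y * Λ y I) * Λ y J) x := fun I J =>
      (hdμ.mul (hdΛ I)).mul (hdΛ J)
    have hp : ∀ I J, fderiv ℝ (fun y => (μ y * Λ y I) * Λ y J) x (Pi.single a 1)
        = pd (fun y => μ y * Λ y I) a x * Λ x J + μ x * Λ x I * pd (fun y => Λ y J) a x :=
      fun I J => pd_mul (hdμ.mul (hdΛ I)) (hdΛ J) a
    unfold pd at hp ⊢
    rw [he.fderiv_eq, fderiv_const_mul (((hm _ _).fun_add (hm _ _)).fun_add (hm _ _)),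
      fderiv_fun_add ((hm _ _).fun_add (hm _ _)) (hm _ _), fderiv_fun_add (hm _ _) (hm _ _)]
    simp only [smul_apply, add_apply, hp, smul_eq_mul]
    rw [(hΛ.1 x hx).swap j l]
    ring
  have h3 := sharpF_congr_apply Λ₀ (hδ x hx) ![j, k, l]
  have h5 : sharpF Λ₀ 3 (smulF 2 (wedgeF 2 1 σ (codiffF ω₀ Λ₀ 2 σ))) x ![j, k, l]
      = 2 * sharpF Λ₀ (2 + 1) (wedgeF 2 1 σ (codiffF ω₀ Λ₀ 2 σ)) x ![j, k, l] := by
    unfold sharpF smulF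
    simp only [mul_assoc, ← Finset.mul_sum]
    ring
  have h6 : ∑ a, pd (fun y => μ y * sharpF Λ₀ 4 (wedgeF 2 2 σ σ) y ![a, j, k, l]) a x
      = 2 * (V j * Λ x ![k, l] - V k * Λ x ![j, l] + V l * Λ x ![j, k] + μ x *
        ∑ a, (Λ x ![a, j] * pd (fun y => Λ y ![k, l]) a x
            + Λ x ![a, k] * pd (fun y => Λ y ![l, j]) a x
            + Λ x ![a, l] * pd (fun y => Λ y ![j, k]) a x)) := by
    simp only [hpd, hV, Finset.sum_mul, Finset.mul_sum, ← Finset.sum_sub_distrib,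
      ← Finset.sum_add_distrib]
  rw [h5, sharpF_wedgeF, wedgeF_two_one (hΛ.1 x hx), hv, hv, hv, h4, h6] at h3
  have h7 : 2 * (μ x * (mat2 Λ₀ x).det * μ x) *
      ∑ a, (Λ x ![a, j] * pd (fun y => Λ y ![k, l]) a x
            + Λ x ![a, k] * pd (fun y => Λ y ![l, j]) a x
            + Λ x ![a, l] * pd (fun y => Λ y ![j, k]) a x) = 0 := by
    linear_combination h3
  exact (mul_eq_zero.1 h7).resolve_left
    (mul_ne_zero two_ne_zero (mul_ne_zero (mul_ne_zero hμ0 hdet) hμ0))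

lemma contDiffAt_pd {N : ℕ} {h : Pt N → ℝ} {x : Pt N} (hh : ContDiffAt ℝ (⊤ : ℕ∞) h x)
    (i : Fin N) : ContDiffAt ℝ (⊤ : ℕ∞) (pd h i) x := by
  unfold pd
  exact (hh.fderiv_right (m := (⊤ : ℕ∞)) (by simp)).clm_apply contDiffAt_const

lemma pd_pd_comm {N : ℕ} {h : Pt N → ℝ} {x : Pt N} (hh : ContDiffAt ℝ (⊤ : ℕ∞) h x)
    (i j : Fin N) : pd (pd h i) j x = pd (pd h j) i x := by
  have hs := hh.isSymmSndFDerivAt (by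
    rw [minSmoothness_of_isRCLikeNormedField]
    exact WithTop.coe_le_coe.2 le_top)
  have hd : DifferentiableAt ℝ (fderiv ℝ h) x :=
    (hh.fderiv_right (m := (⊤ : ℕ∞)) (by simp)).differentiableAt (by simp)
  have key : ∀ a b : Fin N, pd (pd h a) b x
      = fderiv ℝ (fderiv ℝ h) x (Pi.single b 1) (Pi.single a 1) := by
    intro a b
    have : pd h a = fun y => fderiv ℝ h y (Pi.single a 1) := rfl
    rw [this, pd, fderiv_clm_apply hd (differentiableAt_const _)]
    simp
  rw [key, key]
  exact hs _ _

lemma pd_braF {N : ℕ} {Λ : Form N 2} {h k : Pt N → ℝ} {x : Pt N}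
    (hΛ : ∀ I, DifferentiableAt ℝ (fun y => Λ y I) x) (hh : ContDiffAt ℝ (⊤ : ℕ∞) h x)
    (hk : ContDiffAt ℝ (⊤ : ℕ∞) k x) (b : Fin N) :
    pd (braF Λ h k) b x = ∑ i, ∑ j, (pd (fun y => Λ y ![i, j]) b x * pd h i x * pd k j x
      + Λ x ![i, j] * pd (pd h i) b x * pd k j x + Λ x ![i, j] * pd h i x * pd (pd k j) b x) := by
  have hh1 : ∀ i, DifferentiableAt ℝ (pd h i) x := fun i =>
    (contDiffAt_pd hh i).differentiableAt (by simp)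
  have hk1 : ∀ i, DifferentiableAt ℝ (pd k i) x := fun i =>
    (contDiffAt_pd hk i).differentiableAt (by simp)
  have hd : ∀ i j, DifferentiableAt ℝ (fun y => Λ y ![i, j] * pd h i y * pd k j y) x :=
    fun i j => ((hΛ _).mul (hh1 i)).mul (hk1 j)
  unfold braF
  rw [pd_sum fun i _ => DifferentiableAt.fun_sum fun j _ => hd i j]
  refine Finset.sum_congr rfl fun i _ => ?_
  rw [pd_sum fun j _ => hd i j]
  refine Finset.sum_congr rfl fun j _ => ?_
  rw [pd_mul ((hΛ _).fun_mul (hh1 i)) (hk1 j), pd_mul (hΛ _) (hh1 i)]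
  ring

/-- The expansion of an iterated bracket into its first and second order parts. -/
lemma braF_braF {N : ℕ} {Λ : Form N 2} {g h k : Pt N → ℝ} {x : Pt N} (hA : AltArr (Λ x))
    (hΛ : ∀ I, DifferentiableAt ℝ (fun y => Λ y I) x) (hh : ContDiffAt ℝ (⊤ : ℕ∞) h x)
    (hk : ContDiffAt ℝ (⊤ : ℕ∞) k x) :
    braF Λ g (braF Λ h k) x
      = -(∑ p, ∑ q, ∑ r, pd g p x * pd h q x * pd k r x *
          ∑ b, Λ x ![b, p] * pd (fun y => Λ y ![q, r]) b x)
        - (∑ b, ∑ i, (∑ p, Λ x ![b, p] * pd g p x) * pd (pd h i) b x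
            * ∑ p, Λ x ![i, p] * pd k p x)
        + ∑ b, ∑ i, (∑ p, Λ x ![b, p] * pd g p x) * pd (pd k i) b x
            * ∑ p, Λ x ![i, p] * pd h p x := by
  have h1 : ∑ p, ∑ q, ∑ r, pd g p x * pd h q x * pd k r x *
        ∑ b, Λ x ![b, p] * pd (fun y => Λ y ![q, r]) b x
      = ∑ a, ∑ b, ∑ i, ∑ j, Λ x ![b, a] * pd g a x *
        (pd (fun y => Λ y ![i, j]) b x * pd h i x * pd k j x) := by
    refine Finset.sum_congr rfl fun p _ => ?_
    simp only [Finset.mul_sum]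
    rw [Finset.sum_congr rfl fun q _ => Finset.sum_comm, Finset.sum_comm]
    refine Finset.sum_congr rfl fun b _ => Finset.sum_congr rfl fun q _ =>
      Finset.sum_congr rfl fun r _ => by ring
  have h2 : ∑ b, ∑ i, (∑ p, Λ x ![b, p] * pd g p x) * pd (pd h i) b x
            * ∑ p, Λ x ![i, p] * pd k p x
      = ∑ a, ∑ b, ∑ i, ∑ j, Λ x ![b, a] * pd g a x *
        (Λ x ![i, j] * pd (pd h i) b x * pd k j x) := by
    conv_rhs => rw [Finset.sum_comm]
    refine Finset.sum_congr rfl fun b _ => ?_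
    rw [Finset.sum_comm]
    refine Finset.sum_congr rfl fun i _ => ?_
    rw [Finset.sum_mul, Finset.sum_mul_sum]
    exact Finset.sum_congr rfl fun a _ => Finset.sum_congr rfl fun j _ => by ring
  have h3 : ∑ b, ∑ i, (∑ p, Λ x ![b, p] * pd g p x) * pd (pd k i) b x
            * ∑ p, Λ x ![i, p] * pd h p x
      = -∑ a, ∑ b, ∑ i, ∑ j, Λ x ![b, a] * pd g a x *
        (Λ x ![i, j] * pd h i x * pd (pd k j) b x) := by
    conv_rhs => rw [Finset.sum_comm, ← Finset.sum_neg_distrib]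
    refine Finset.sum_congr rfl fun b _ => ?_
    rw [Finset.sum_congr rfl fun a _ => Finset.sum_comm, Finset.sum_comm, ← Finset.sum_neg_distrib]
    refine Finset.sum_congr rfl fun j _ => ?_
    rw [Finset.sum_mul, Finset.sum_mul_sum, ← Finset.sum_neg_distrib]
    refine Finset.sum_congr rfl fun a _ => ?_
    rw [← Finset.sum_neg_distrib]
    refine Finset.sum_congr rfl fun i _ => ?_
    rw [hA.swap j i]
    ring
  rw [h1, h2, h3, sub_eq_add_neg, ← neg_add, ← neg_add, braF]
  simp only [← Finset.sum_add_distrib, ← Finset.sum_neg_distrib]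
  refine Finset.sum_congr rfl fun a _ => Finset.sum_congr rfl fun b _ => ?_
  rw [pd_braF hΛ hh hk, hA.swap b a, Finset.mul_sum]
  refine Finset.sum_congr rfl fun i _ => ?_
  rw [Finset.mul_sum]
  refine Finset.sum_congr rfl fun j _ => ?_
  ring

lemma jacobiOn_of_schouten {N : ℕ} {Λ : Form N 2} {M : Set (Pt N)} (hM : IsOpen M)
    (hΛ : IsFormOn Λ M)
    (hS : ∀ x ∈ M, ∀ j k l, ∑ a, (Λ x ![a, j] * pd (fun y => Λ y ![k, l]) a x
      + Λ x ![a, k] * pd (fun y => Λ y ![l, j]) a x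
      + Λ x ![a, l] * pd (fun y => Λ y ![j, k]) a x) = 0) : JacobiOn Λ M := by
  intro g h k hg hh hk x hx
  replace hg := hg.contDiffAt (hM.mem_nhds hx)
  replace hh := hh.contDiffAt (hM.mem_nhds hx)
  replace hk := hk.contDiffAt (hM.mem_nhds hx)
  have hA := hΛ.1 x hx
  have hd : ∀ I, DifferentiableAt ℝ (fun y => Λ y I) x := fun I =>
    ((hΛ.2 I).contDiffAt (hM.mem_nhds hx)).differentiableAt (by simp)
  rw [braF_braF hA hd hh hk, braF_braF hA hd hk hg, braF_braF hA hd hg hh]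
  have hsymm : ∀ {f : Pt N → ℝ}, ContDiffAt ℝ (⊤ : ℕ∞) f x → ∀ u v : Fin N → ℝ,
      ∑ b, ∑ i, u b * pd (pd f i) b x * v i = ∑ b, ∑ i, v b * pd (pd f i) b x * u i := by
    intro f hf u v
    rw [Finset.sum_comm]
    refine Finset.sum_congr rfl fun b _ => Finset.sum_congr rfl fun i _ => ?_
    rw [pd_pd_comm hf]
    ring
  set u := fun b => ∑ p, Λ x ![b, p] * pd g p x with hu
  set v := fun b => ∑ p, Λ x ![b, p] * pd h p x with hv
  set w := fun b => ∑ p, Λ x ![b, p] * pd k p x with hw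
  set S := fun p q r => ∑ b, Λ x ![b, p] * pd (fun y => Λ y ![q, r]) b x with hSdef
  have h0 : ∀ p q r, S p q r + S q r p + S r p q = 0 := by
    intro p q r
    rw [← hS x hx p q r]
    simp only [hSdef, Finset.sum_add_distrib]
  have hT : ∑ p, ∑ q, ∑ r, pd g p x * pd h q x * pd k r x * S p q r
      + ∑ p, ∑ q, ∑ r, pd h p x * pd k q x * pd g r x * S p q r
      + ∑ p, ∑ q, ∑ r, pd k p x * pd g q x * pd h r x * S p q r = 0 := by
    have e1 : ∑ p, ∑ q, ∑ r, pd h p x * pd k q x * pd g r x * S p q r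
        = ∑ p, ∑ q, ∑ r, pd g p x * pd h q x * pd k r x * S q r p := by
      rw [Finset.sum_congr rfl fun p _ => Finset.sum_comm, Finset.sum_comm]
      exact Finset.sum_congr rfl fun p _ => Finset.sum_congr rfl fun q _ =>
        Finset.sum_congr rfl fun r _ => by ring
    have e2 : ∑ p, ∑ q, ∑ r, pd k p x * pd g q x * pd h r x * S p q r
        = ∑ p, ∑ q, ∑ r, pd g p x * pd h q x * pd k r x * S r p q := by
      rw [Finset.sum_comm, Finset.sum_congr rfl fun p _ => Finset.sum_comm]
      exact Finset.sum_congr rfl fun p _ => Finset.sum_congr rfl fun q _ =>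
        Finset.sum_congr rfl fun r _ => by ring
    rw [e1, e2]
    simp only [← Finset.sum_add_distrib]
    refine Finset.sum_eq_zero fun p _ => Finset.sum_eq_zero fun q _ =>
      Finset.sum_eq_zero fun r _ => ?_
    linear_combination (pd g p x * pd h q x * pd k r x) * h0 p q r
  have s1 := hsymm hg v w
  have s2 := hsymm hh u w
  have s3 := hsymm hk u v
  linear_combination -hT + s1 - s2 + s3

end

theorem poisson_with_prescribed_casimirs_even
    (n k : ℕ) (hk : 2 ≤ k) (hkn : k ≤ n)
    (M : Set (Pt (2 * n))) (hMo : IsOpen M) (hMne : M.Nonempty)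
    (f : Fin (2 * (n - k)) → Pt (2 * n) → ℝ)
    (hf : ∀ i, ContDiffOn ℝ (⊤ : ℕ∞) (f i) M)
    -- functional independence on an open dense subset U₁ of M
    (U₁ : Set (Pt (2 * n))) (hU₁o : IsOpen U₁) (hU₁M : U₁ ⊆ M) (hU₁d : M ⊆ closure U₁)
    (hind : ∀ x ∈ U₁, LinearIndependent ℝ fun i => grad (f i) x)
    -- almost symplectic structure with f nonvanishing on an open dense U ⊆ M
    (ω₀ Λ₀ : Form (2 * n) 2) (hsymp : AlmostSymp ω₀ Λ₀ M)
    (U : Set (Pt (2 * n))) (hUo : IsOpen U) (hUM : U ⊆ M) (hUd : M ⊆ closure U)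
    (hfne : ∀ x ∈ U, fEven Λ₀ f x ≠ 0)
    -- σ : section of ⋀²D° of maximal rank 2k on U satisfying the δ-condition
    (σ : Form (2 * n) 2) (hσ : IsFormOn σ M)
    (hσD : ∀ i, ∀ x ∈ M, ∀ b, ∑ a, σ x ![a, b] * hamV Λ₀ (f i) x a = 0)
    (hσrank : ∀ x ∈ U, Matrix.rank (mat2 σ x) = 2 * k)
    (hδ : DeltaCond ω₀ Λ₀ σ M) :
    -- Ψ⁻¹(Φ) = Λ₀^#(σ) on U
    (∀ x ∈ U, ∀ I : Fin 2 → Fin (2 * n),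
        castF (by omega)
          (jF (2 + 2 * (k - 2) + 2 * (n - k)) (2 * n) (PhiForm k ω₀ Λ₀ σ f) (volF n Λ₀))
          x I
        = sharpF Λ₀ 2 σ x I) ∧
    -- Λ = Λ₀^#(σ) is a Poisson tensor on M …
    JacobiOn (sharpF Λ₀ 2 σ) M ∧
    -- … of rank at most 2k everywhere …
    (∀ x ∈ M, Matrix.rank (mat2 (sharpF Λ₀ 2 σ) x) ≤ 2 * k) ∧
    -- … admitting f₁,…,f_{2(n-k)} as Casimirs …
    (∀ i, CasimirOn (sharpF Λ₀ 2 σ) (f i) M) ∧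
    -- … and whose bracket satisfies {h₁,h₂}·Ω = Φ(h₁,h₂) on U:
    (∀ h₁ h₂ : Pt (2 * n) → ℝ,
        ContDiffOn ℝ (⊤ : ℕ∞) h₁ M → ContDiffOn ℝ (⊤ : ℕ∞) h₂ M →
        ∀ x ∈ U, ∀ I : Fin (2 * n) → Fin (2 * n),
        braF (sharpF Λ₀ 2 σ) h₁ h₂ x * volF n ω₀ x I
          = -(fEven Λ₀ f x)⁻¹ *
            castF (by omega)
              (wedgeF 2 (2 + 2 * (k - 2) + 2 * (n - k))
                (wedgeF 1 1 (dF h₁) (dF h₂)) (coreForm k ω₀ Λ₀ σ f)) x I) := by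
  have hrank : ∀ x ∈ M, (mat2 σ x).rank ≤ 2 * k := fun x hx =>
    rank_le_of_dense hMo (fun I => (hσ.2 I).continuousOn) hUd (fun y hy => (hσrank y hy).le) hx
  refine ⟨fun x hx I => ?_, ?_, fun x hx => ?_, fun i x hx b => ?_, fun h₁ h₂ _ _ x hx I => ?_⟩
  · exact Psi_inv_PhiForm hk hkn (hsymp.sympPair (hUM hx)) (hσ.1 x (hUM hx))
      (fun i b => hσD i x (hUM hx) b) (hfne x hx) (by omega) I
  · exact jacobiOn_of_schouten hMo (hσ.sharpF hsymp.2.1) fun x hx j k l =>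
      hδ.schouten (hk.trans hkn) hMo hsymp hσ hx j k l
  · exact (rank_sharpF_le Λ₀ σ x).trans (hrank x hx)
  · exact casimir_sharpF (hsymp.2.1.1 x hx) (hσ.1 x hx) (fun b => hσD i x hx b) b
  · exact braF_mul_volF hk hkn (hsymp.sympPair (hUM hx)) (hσ.1 x (hUM hx))
      (fun i b => hσD i x (hUM hx) b) (hfne x hx) (by omega) h₁ h₂ I

end
end Damianou
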